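/- arXiv:2104.05161 — 9 statements merged into one kernel-verified Lean document; each statement's English description precedes it below -/
import Mathlib

section
/- Let V be a polynomial with real coefficients, let ψᵢ, ψⱼ : ℝ → ℂ be Schwartz functions, and let Eᵢ, Eⱼ ∈ ℝ with Eᵢ ≠ Eⱼ be such that −(1/2)ψᵢ''(x) + V(x)ψᵢ(x) = Eᵢψᵢ(x) and −(1/2)ψⱼ''(x) + V(x)ψⱼ(x) = Eⱼψⱼ(x) for all x ∈ ℝ. Let f̃ : ℝ² → ℂ be a Schwartz function satisfying, for all (u,v) ∈ ℝ², −(1/2)∂²f̃/∂u²(u,v) + V(u)f̃(u,v) = −(1/2)∂²f̃/∂v²(u,v) + V(v)f̃(u,v). Then ∬_{ℝ²} f̃(u,v) · ψᵢ(u) · conj(ψⱼ(v)) du dv = 0. -/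
open MeasureTheory

open scoped SchwartzMap LineDeriv

/-- Real polynomial functions have temperate growth. -/
lemma Polynomial.hasTemperateGrowth_eval (P : Polynomial ℝ) :
    Function.HasTemperateGrowth (fun x : ℝ => P.eval x) := by
  simp only [Polynomial.eval_eq_sum, Polynomial.sum]
  fun_prop

namespace SchwartzMap

/-- The restriction of a Schwartz function on the plane to a horizontal line. -/
noncomputable def sliceLeft (f : 𝓢(ℝ × ℝ, ℂ)) (v : ℝ) : 𝓢(ℝ, ℂ) :=
  compCLMOfAntilipschitz (K := 1) ℝ (g := fun u : ℝ => (u, v))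
    (by
      have h : (fun u : ℝ => (u, v)) =
          fun u => ContinuousLinearMap.inl ℝ ℝ ℝ u + ((0, v) : ℝ × ℝ) := by
        ext u <;> simp
      rw [h]
      fun_prop)
    (fun x y => by simp [Prod.edist_eq]) f

/-- The restriction of a Schwartz function on the plane to a vertical line. -/
noncomputable def sliceRight (f : 𝓢(ℝ × ℝ, ℂ)) (u : ℝ) : 𝓢(ℝ, ℂ) :=
  sliceLeft (compCLMOfContinuousLinearEquiv ℝ (ContinuousLinearEquiv.prodComm ℝ ℝ ℝ) f) u

lemma deriv_sliceLeft (f : 𝓢(ℝ × ℝ, ℂ)) (v : ℝ) :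
    deriv (fun u => f (u, v)) = fun u => (∂_{((1, 0) : ℝ × ℝ)} f) (u, v) := by
  ext u
  rw [lineDerivOp_apply_eq_fderiv]
  exact ((f.hasFDerivAt (u, v)).comp_hasDerivAt u
    ((hasDerivAt_id u).prodMk (hasDerivAt_const u v))).deriv

lemma integrable_mul (f g : 𝓢(ℝ, ℂ)) : Integrable (fun x => f x * g x) :=
  (pairing (ContinuousLinearMap.mul ℝ ℂ) f g).integrable

/-- Green's identity on the line: the pairing of `(-½ ∂² + W) s` with an eigenfunction `ψ` of
`-½ ∂² + W` is the eigenvalue times the pairing of `s` with `ψ`. -/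
lemma integral_schrodinger_mul_eigenfunction (W : ℝ → ℂ) (ψ s : 𝓢(ℝ, ℂ)) (E : ℂ)
    (hψ : ∀ x, -(1/2 : ℂ) * deriv (deriv (ψ : ℝ → ℂ)) x + W x * ψ x = E * ψ x) :
    ∫ x, (-(1/2 : ℂ) * deriv (deriv (s : ℝ → ℂ)) x + W x * s x) * ψ x
      = E * ∫ x, s x * ψ x := by
  have green : ∫ x, deriv (deriv (s : ℝ → ℂ)) x * ψ x
      = ∫ x, s x * deriv (deriv (ψ : ℝ → ℂ)) x := by
    have h₁ := integral_mul_deriv_eq_neg_deriv_mul s (derivCLM ℝ ℂ ψ)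
    have h₂ := integral_mul_deriv_eq_neg_deriv_mul (derivCLM ℝ ℂ s) ψ
    exact (neg_eq_iff_eq_neg.mp h₂.symm).trans h₁.symm
  have i₀ := integrable_mul s ψ
  have i₁ : Integrable fun x => deriv (deriv (s : ℝ → ℂ)) x * ψ x :=
    integrable_mul (derivCLM ℝ ℂ (derivCLM ℝ ℂ s)) ψ
  have i₂ : Integrable fun x => s x * deriv (deriv (ψ : ℝ → ℂ)) x :=
    integrable_mul s (derivCLM ℝ ℂ (derivCLM ℝ ℂ ψ))
  calc
    _ = ∫ x, (E * (s x * ψ x) + -(1/2 : ℂ) *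
          (deriv (deriv (s : ℝ → ℂ)) x * ψ x - s x * deriv (deriv (ψ : ℝ → ℂ)) x)) := by
      congr 1 with x
      linear_combination s x * hψ x
    _ = E * ∫ x, s x * ψ x := by
      have i₃ : Integrable fun x =>
          deriv (deriv (s : ℝ → ℂ)) x * ψ x - s x * deriv (deriv (ψ : ℝ → ℂ)) x := i₁.sub i₂
      rw [integral_add (i₀.const_mul E) (i₃.const_mul _), integral_const_mul,
        integral_const_mul, integral_sub i₁ i₂, green, sub_self, mul_zero, add_zero]

/-- The product of a Schwartz function on the plane with a tensor product of Schwartz functions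
on the line is integrable. -/
lemma integrable_mul_tensor (F : 𝓢(ℝ × ℝ, ℂ)) (φ χ : 𝓢(ℝ, ℂ)) :
    Integrable (fun p : ℝ × ℝ => F p * φ p.1 * χ p.2) := by
  have hφ : Integrable (fun p : ℝ × ℝ => F p * φ p.1) :=
    F.integrable.mul_bdd (c := SchwartzMap.seminorm ℝ 0 0 φ)
      (φ.continuous.comp continuous_fst).aestronglyMeasurable
      (.of_forall fun p => norm_le_seminorm ℝ φ p.1)
  exact hφ.mul_bdd (c := SchwartzMap.seminorm ℝ 0 0 χ)
    (χ.continuous.comp continuous_snd).aestronglyMeasurable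
    (.of_forall fun p => norm_le_seminorm ℝ χ p.2)

/-- The Schrödinger operator with polynomial potential in the first variable preserves Schwartz
functions on the plane. -/
lemma exists_eq_schrodinger_left (V : Polynomial ℝ) (f : 𝓢(ℝ × ℝ, ℂ)) :
    ∃ F : 𝓢(ℝ × ℝ, ℂ), ∀ u v : ℝ, F (u, v) =
      -(1/2 : ℂ) * deriv (deriv (fun u' : ℝ => f (u', v))) u
        + ((V.eval u : ℝ) : ℂ) * f (u, v) := by
  have hV : Function.HasTemperateGrowth (fun p : ℝ × ℝ => ((V.eval p.1 : ℝ) : ℂ)) :=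
    Function.HasTemperateGrowth.comp Complex.ofRealCLM.hasTemperateGrowth (V.hasTemperateGrowth_eval.comp
      (ContinuousLinearMap.fst ℝ ℝ ℝ).hasTemperateGrowth)
  refine ⟨(-(1/2 : ℂ)) • ∂_{((1, 0) : ℝ × ℝ)} (∂_{((1, 0) : ℝ × ℝ)} f)
    + smulLeftCLM ℂ (fun p : ℝ × ℝ => ((V.eval p.1 : ℝ) : ℂ)) f, fun u v => ?_⟩
  rw [deriv_sliceLeft, deriv_sliceLeft, add_apply, smul_apply, smulLeftCLM_apply_apply hV,
    smul_eq_mul, smul_eq_mul]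

/-- The complex conjugate of a Schwartz function. -/
noncomputable def conj (ψ : 𝓢(ℝ, ℂ)) : 𝓢(ℝ, ℂ) :=
  ψ.postcompCLM (Complex.conjCLE : ℂ →L[ℝ] ℂ)

lemma coe_conj (ψ : 𝓢(ℝ, ℂ)) : (conj ψ : ℝ → ℂ) = fun x => starRingEnd ℂ (ψ x) := rfl

lemma deriv_deriv_conj (ψ : 𝓢(ℝ, ℂ)) (x : ℝ) :
    deriv (deriv (conj ψ : ℝ → ℂ)) x = starRingEnd ℂ (deriv (deriv (ψ : ℝ → ℂ)) x) := by
  have h (φ : 𝓢(ℝ, ℂ)) : deriv (conj φ : ℝ → ℂ) = conj (derivCLM ℝ ℂ φ) := by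
    ext y
    exact ((Complex.conjCLE : ℂ →L[ℝ] ℂ).hasFDerivAt.comp_hasDerivAt y (φ.hasDerivAt y)).deriv
  rw [h, h]
  rfl

end SchwartzMap

/-- If `f̃` solves `[H_s(u) - H_s(v)] f̃ = 0` (the stationary Wigner equation after the
change of variables `u = x + y/2`, `v = x - y/2`), then `f̃` is orthogonal to the mixed
products of Schrödinger eigenfunctions with distinct eigenvalues. -/
theorem stationary_wigner_orthogonal_to_mixed_products
    (V : Polynomial ℝ) (ψi ψj : SchwartzMap ℝ ℂ) (Ei Ej : ℝ) (hE : Ei ≠ Ej)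
    (hi : ∀ x : ℝ,
      -(1/2 : ℂ) * deriv (deriv (ψi : ℝ → ℂ)) x + ((V.eval x : ℝ) : ℂ) * ψi x = (Ei : ℂ) * ψi x)
    (hj : ∀ x : ℝ,
      -(1/2 : ℂ) * deriv (deriv (ψj : ℝ → ℂ)) x + ((V.eval x : ℝ) : ℂ) * ψj x = (Ej : ℂ) * ψj x)
    (f : SchwartzMap (ℝ × ℝ) ℂ)
    (hf : ∀ u v : ℝ,
      -(1/2 : ℂ) * deriv (deriv (fun u' : ℝ => f (u', v))) u + ((V.eval u : ℝ) : ℂ) * f (u, v)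
        = -(1/2 : ℂ) * deriv (deriv (fun v' : ℝ => f (u, v'))) v + ((V.eval v : ℝ) : ℂ) * f (u, v)) :
    ∫ u : ℝ, ∫ v : ℝ, f (u, v) * ψi u * (starRingEnd ℂ) (ψj v) = 0 := by
  set χ := SchwartzMap.conj ψj with hχdef
  have hχ : ∀ x : ℝ, -(1/2 : ℂ) * deriv (deriv (χ : ℝ → ℂ)) x + ((V.eval x : ℝ) : ℂ) * χ x
      = (Ej : ℂ) * χ x := fun x => by
    rw [hχdef, SchwartzMap.deriv_deriv_conj, SchwartzMap.coe_conj]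
    simpa [Complex.conj_ofNat] using congrArg (starRingEnd ℂ) (hj x)
  change ∫ u : ℝ, ∫ v : ℝ, f (u, v) * ψi u * χ v = 0
  obtain ⟨F, hF⟩ := SchwartzMap.exists_eq_schrodinger_left V f
  have hleft : ∫ u : ℝ, ∫ v : ℝ, F (u, v) * ψi u * χ v
      = Ei * ∫ u : ℝ, ∫ v : ℝ, f (u, v) * ψi u * χ v := by
    rw [integral_integral_swap (SchwartzMap.integrable_mul_tensor F ψi χ),
      integral_integral_swap (f := fun u v => f (u, v) * ψi u * χ v)
        (SchwartzMap.integrable_mul_tensor f ψi χ), ← integral_const_mul]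
    congr 1 with v
    simp only [integral_mul_const, hF, ← mul_assoc]
    exact congrArg (· * χ v) (SchwartzMap.integral_schrodinger_mul_eigenfunction
      (fun x => ((V.eval x : ℝ) : ℂ)) ψi (f.sliceLeft v) Ei hi)
  have hright : ∫ u : ℝ, ∫ v : ℝ, F (u, v) * ψi u * χ v
      = Ej * ∫ u : ℝ, ∫ v : ℝ, f (u, v) * ψi u * χ v := by
    rw [← integral_const_mul]
    congr 1 with u
    simp only [hF, hf, mul_right_comm _ (ψi u), integral_mul_const, ← mul_assoc]
    exact congrArg (· * ψi u) (SchwartzMap.integral_schrodinger_mul_eigenfunction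
      (fun x => ((V.eval x : ℝ) : ℂ)) χ (f.sliceRight u) Ej hχ)
  have hne : (Ei : ℂ) - Ej ≠ 0 := sub_ne_zero.mpr (by exact_mod_cast hE)
  refine (mul_eq_zero.mp ?_).resolve_left hne
  rw [sub_mul, ← hleft, ← hright, sub_self]
end

section
/- Let V be a polynomial with real coefficients, E ∈ ℝ, and let ψ : ℝ → ℂ be a Schwartz function satisfying −(1/2)ψ''(x) + V(x)ψ(x) = Eψ(x) for all x ∈ ℝ. Define the Wigner function f(x,p) = (1/(2π)) ∫_ℝ conj(ψ(x + y/2)) ψ(x − y/2) e^{−i p y} dy. Then f satisfies the stationary Wigner equation: for all (x,p) ∈ ℝ², p · ∂f/∂x(x,p) = Σ_{m ≥ 0} (1/((2m+1)! · (−4)^m)) · V^{(2m+1)}(x) · ∂^{2m+1}f/∂p^{2m+1}(x,p), where V^{(k)} denotes the k-th derivative of V and the sum has finitely many nonzero terms since V is a polynomial. -/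
open MeasureTheory

/-- The integrand of the cross-Wigner transform of `a` and `b`, without its phase factor. -/
noncomputable def crossKernel (a b : SchwartzMap ℝ ℂ) (x y : ℝ) : ℂ :=
  (starRingEnd ℂ) (a (x + y / 2)) * b (x - y / 2)

/-- The derivative of a Schwartz function, as a Schwartz function. -/
noncomputable def schwartzDeriv (a : SchwartzMap ℝ ℂ) : SchwartzMap ℝ ℂ :=
  SchwartzMap.derivCLM ℝ ℂ a

lemma schwartzDeriv_apply (a : SchwartzMap ℝ ℂ) (x : ℝ) :
    schwartzDeriv a x = deriv a x := rfl

lemma hasDerivAt_schwartzDeriv (a : SchwartzMap ℝ ℂ) (x : ℝ) :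
    HasDerivAt a (schwartzDeriv a x) x := a.hasDerivAt x

lemma continuous_crossKernel (a b : SchwartzMap ℝ ℂ) (x : ℝ) :
    Continuous (crossKernel a b x) := by
  have ha := a.continuous
  have hb := b.continuous
  unfold crossKernel
  fun_prop

lemma SchwartzMap.exists_one_add_abs_pow_mul_norm_le (a : SchwartzMap ℝ ℂ) (k : ℕ) :
    ∃ C, ∀ x : ℝ, (1 + |x|) ^ k * ‖a x‖ ≤ C := by
  have h := SchwartzMap.one_add_le_sup_seminorm_apply (𝕜 := ℝ) (m := (k, 0)) le_rfl le_rfl a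
  simp only [norm_iteratedFDeriv_zero, Real.norm_eq_abs] at h
  exact ⟨_, h⟩

lemma exists_integrable_bound_crossKernel (a b : SchwartzMap ℝ ℂ) (n : ℕ) :
    ∃ B : ℝ → ℝ, Integrable B ∧ ∀ x y : ℝ, |y| ^ n * ‖crossKernel a b x y‖ ≤ B y := by
  obtain ⟨C, hC⟩ := a.exists_one_add_abs_pow_mul_norm_le (n + 2)
  obtain ⟨D, hD⟩ := b.exists_one_add_abs_pow_mul_norm_le (n + 2)
  have hint : Integrable (fun y : ℝ => (1 + ‖y‖) ^ (-2 : ℝ)) :=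
    integrable_one_add_norm (by norm_num)
  refine ⟨fun y => C * D * (1 + ‖y‖) ^ (-2 : ℝ), hint.const_mul _, fun x y => ?_⟩
  have hC0 : 0 ≤ C := le_trans (by positivity) (hC 0)
  have hy : 1 + |y| ≤ (1 + |x + y / 2|) * (1 + |x - y / 2|) := by
    have h := abs_sub (x + y / 2) (x - y / 2)
    rw [show x + y / 2 - (x - y / 2) = y by ring] at h
    nlinarith [mul_nonneg (abs_nonneg (x + y / 2)) (abs_nonneg (x - y / 2))]
  have hprod : (1 + |y|) ^ (n + 2) * ‖crossKernel a b x y‖ ≤ C * D := by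
    calc (1 + |y|) ^ (n + 2) * ‖crossKernel a b x y‖
        ≤ ((1 + |x + y / 2|) * (1 + |x - y / 2|)) ^ (n + 2) * ‖crossKernel a b x y‖ := by
          gcongr
      _ = ((1 + |x + y / 2|) ^ (n + 2) * ‖a (x + y / 2)‖) *
            ((1 + |x - y / 2|) ^ (n + 2) * ‖b (x - y / 2)‖) := by
          simp only [crossKernel, norm_mul, RCLike.norm_conj, mul_pow _ _ (n + 2)]
          ring
      _ ≤ C * D := mul_le_mul (hC _) (hD _) (by positivity) hC0
  have hpow : |y| ^ n ≤ (1 + |y|) ^ n := by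
    gcongr
    linarith
  beta_reduce
  rw [Real.norm_eq_abs y, Real.rpow_neg (by positivity), Real.rpow_two, ← div_eq_mul_inv,
    le_div_iff₀ (by positivity)]
  calc |y| ^ n * ‖crossKernel a b x y‖ * (1 + |y|) ^ 2
      ≤ (1 + |y|) ^ n * ‖crossKernel a b x y‖ * (1 + |y|) ^ 2 := by gcongr
    _ = (1 + |y|) ^ (n + 2) * ‖crossKernel a b x y‖ := by ring
    _ ≤ C * D := hprod

lemma norm_exp_neg_I_mul (p y : ℝ) : ‖Complex.exp (-Complex.I * p * y)‖ = 1 := by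
  rw [show -Complex.I * (p : ℂ) * y = ((-(p * y) : ℝ) : ℂ) * Complex.I by push_cast; ring]
  exact Complex.norm_exp_ofReal_mul_I _

lemma integrable_pow_mul_crossKernel (a b : SchwartzMap ℝ ℂ) (x p : ℝ) (n : ℕ) :
    Integrable fun y : ℝ =>
      (-Complex.I * y) ^ n * crossKernel a b x y * Complex.exp (-Complex.I * p * y) := by
  obtain ⟨B, hB, hle⟩ := exists_integrable_bound_crossKernel a b n
  have hc := continuous_crossKernel a b x
  refine hB.mono' (Continuous.aestronglyMeasurable (by fun_prop)) (ae_of_all _ fun y => ?_)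
  simpa [-neg_mul, norm_exp_neg_I_mul] using hle x y

lemma integrable_crossKernel (a b : SchwartzMap ℝ ℂ) (x p : ℝ) :
    Integrable fun y : ℝ => crossKernel a b x y * Complex.exp (-Complex.I * p * y) := by
  simpa using integrable_pow_mul_crossKernel a b x p 0

lemma hasDerivAt_crossKernel_left (a b : SchwartzMap ℝ ℂ) (x y : ℝ) :
    HasDerivAt (fun x' => crossKernel a b x' y)
      (crossKernel (schwartzDeriv a) b x y + crossKernel a (schwartzDeriv b) x y) x := by
  have ha := ((hasDerivAt_schwartzDeriv a (x + y / 2)).comp_add_const x (y / 2)).star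
  have hb := (hasDerivAt_schwartzDeriv b (x - y / 2)).comp_sub_const x (y / 2)
  exact ha.mul hb

lemma hasDerivAt_crossKernel_right (a b : SchwartzMap ℝ ℂ) (x y : ℝ) :
    HasDerivAt (crossKernel a b x)
      (1 / 2 * (crossKernel (schwartzDeriv a) b x y - crossKernel a (schwartzDeriv b) x y)) y := by
  have hy : HasDerivAt (fun y : ℝ => y / 2) (1 / 2) y := (hasDerivAt_id y).div_const 2
  have ha := ((hasDerivAt_schwartzDeriv a (x + y / 2)).scomp y (hy.const_add x)).star
  have hb := (hasDerivAt_schwartzDeriv b (x - y / 2)).scomp y (hy.const_sub x)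
  refine (ha.mul hb).congr_deriv ?_
  simp [crossKernel]
  ring

lemma hasDerivAt_integral_crossKernel (a b : SchwartzMap ℝ ℂ) (x p : ℝ) :
    HasDerivAt (fun x' => ∫ y : ℝ, crossKernel a b x' y * Complex.exp (-Complex.I * p * y))
      (∫ y : ℝ, (crossKernel (schwartzDeriv a) b x y + crossKernel a (schwartzDeriv b) x y) *
        Complex.exp (-Complex.I * p * y)) x := by
  obtain ⟨B, hB, hBle⟩ := exists_integrable_bound_crossKernel (schwartzDeriv a) b 0
  obtain ⟨D, hD, hDle⟩ := exists_integrable_bound_crossKernel a (schwartzDeriv b) 0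
  refine (hasDerivAt_integral_of_dominated_loc_of_deriv_le (bound := B + D)
    (F' := fun x y => (crossKernel (schwartzDeriv a) b x y + crossKernel a (schwartzDeriv b) x y) *
        Complex.exp (-Complex.I * p * y)) Filter.univ_mem
    (Filter.Eventually.of_forall fun x' => (integrable_crossKernel a b x' p).1)
    (integrable_crossKernel a b x p) ?_ (ae_of_all _ fun y x' _ => ?_) (hB.add hD)
    (ae_of_all _ fun y x' _ => (hasDerivAt_crossKernel_left a b x' y).mul_const _)).2
  · simpa only [add_mul] using! ((integrable_crossKernel (schwartzDeriv a) b x p).add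
      (integrable_crossKernel a (schwartzDeriv b) x p)).1
  · rw [norm_mul, norm_exp_neg_I_mul, mul_one]
    exact (norm_add_le _ _).trans (add_le_add (by simpa using hBle x' y) (by simpa using hDle x' y))

lemma iteratedDeriv_integral_crossKernel (a b : SchwartzMap ℝ ℂ) (x : ℝ) (n : ℕ) :
    iteratedDeriv n
        (fun q : ℝ => ∫ y : ℝ, crossKernel a b x y * Complex.exp (-Complex.I * q * y)) =
      fun q : ℝ => ∫ y : ℝ,
        (-Complex.I * y) ^ n * crossKernel a b x y * Complex.exp (-Complex.I * q * y) := by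
  induction n with
  | zero => simp
  | succ n ih =>
    rw [iteratedDeriv_succ, ih]
    ext p
    obtain ⟨B, hB, hle⟩ := exists_integrable_bound_crossKernel a b (n + 1)
    refine (hasDerivAt_integral_of_dominated_loc_of_deriv_le (bound := B)
      (F' := fun (q : ℝ) (y : ℝ) => (-Complex.I * y) ^ (n + 1) * crossKernel a b x y *
        Complex.exp (-Complex.I * q * y)) Filter.univ_mem
      (Filter.Eventually.of_forall fun q => (integrable_pow_mul_crossKernel a b x q n).1)
      (integrable_pow_mul_crossKernel a b x p n)
      (integrable_pow_mul_crossKernel a b x p (n + 1)).1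
      (ae_of_all _ fun y q _ => ?_) hB (ae_of_all _ fun y q _ => ?_)).2.deriv
    · simpa [-neg_mul, norm_exp_neg_I_mul] using hle x y
    · have h : HasDerivAt (fun q : ℝ => -Complex.I * (q : ℂ) * y) (-Complex.I * 1 * y) q :=
        (Complex.ofRealCLM.hasDerivAt.const_mul (-Complex.I)).mul_const _
      refine (h.cexp.const_mul _).congr_deriv ?_
      ring

lemma Polynomial.eval_add_eq_sum_iterate_derivative (V : Polynomial ℝ) (x t : ℝ) {n : ℕ}
    (hn : V.natDegree < n) :
    V.eval (x + t) = ∑ k ∈ Finset.range n,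
      (Polynomial.derivative^[k] V).eval x / k.factorial * t ^ k := by
  rw [add_comm, ← Polynomial.taylor_eval, Polynomial.eval_eq_sum_range' (n := n) (by simpa)]
  refine Finset.sum_congr rfl fun k _ => ?_
  rw [Polynomial.taylor_coeff, ← Polynomial.factorial_smul_hasseDeriv]
  have := k.factorial_ne_zero
  rw [LinearMap.smul_apply, Polynomial.eval_smul, nsmul_eq_mul]
  field_simp

lemma Finset.sum_range_two_mul_sub_neg (c : ℕ → ℝ) (t : ℝ) (n : ℕ) :
    ∑ k ∈ Finset.range (2 * n), c k * t ^ k - ∑ k ∈ Finset.range (2 * n), c k * (-t) ^ k =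
      ∑ m ∈ Finset.range n, 2 * c (2 * m + 1) * t ^ (2 * m + 1) := by
  induction n with
  | zero => simp
  | succ n ih =>
    rw [Finset.sum_range_succ, ← ih, Nat.mul_succ, Finset.sum_range_succ, Finset.sum_range_succ,
      Finset.sum_range_succ, Finset.sum_range_succ, Even.neg_pow (by simp),
      Odd.neg_pow (by simp)]
    ring

lemma Polynomial.eval_add_half_sub_eval_sub_half (V : Polynomial ℝ) (x y : ℝ) :
    V.eval (x + y / 2) - V.eval (x - y / 2) = ∑ m ∈ Finset.range (V.natDegree + 1),
      (Polynomial.derivative^[2 * m + 1] V).eval x / ((2 * m + 1).factorial * 4 ^ m) *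
        y ^ (2 * m + 1) := by
  rw [sub_eq_add_neg x, V.eval_add_eq_sum_iterate_derivative x (y / 2)
      (n := 2 * (V.natDegree + 1)) (by lia),
    V.eval_add_eq_sum_iterate_derivative x (-(y / 2)) (n := 2 * (V.natDegree + 1)) (by lia),
    Finset.sum_range_two_mul_sub_neg]
  refine Finset.sum_congr rfl fun m _ => ?_
  rw [div_pow, pow_succ 2, pow_mul 2]
  norm_num
  field_simp

/-- Integration by parts in the relative coordinate `y`, in which the mixed terms cancel. -/
lemma mul_integral_crossKernel_deriv (a : SchwartzMap ℝ ℂ) (x p : ℝ) :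
    (p : ℂ) * ∫ y : ℝ,
        (crossKernel (schwartzDeriv a) a x y + crossKernel a (schwartzDeriv a) x y) *
          Complex.exp (-Complex.I * p * y) =
      -Complex.I * ∫ y : ℝ, 1 / 2 * (crossKernel (schwartzDeriv (schwartzDeriv a)) a x y -
        crossKernel a (schwartzDeriv (schwartzDeriv a)) x y) *
          Complex.exp (-Complex.I * p * y) := by
  set a' := schwartzDeriv a
  set a'' := schwartzDeriv a'
  have hint : Integrable fun y : ℝ => (crossKernel a' a x y + crossKernel a a' x y) *
      Complex.exp (-Complex.I * p * y) := by
    simpa only [add_mul] using!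
      (integrable_crossKernel a' a x p).add (integrable_crossKernel a a' x p)
  have hint' : Integrable fun y : ℝ =>
      1 / 2 * (crossKernel a'' a x y - crossKernel a a'' x y) *
        Complex.exp (-Complex.I * p * y) := by
    simpa only [sub_mul, Pi.sub_apply, mul_assoc] using
      ((integrable_crossKernel a'' a x p).sub (integrable_crossKernel a a'' x p)).const_mul (1 / 2)
  have hderiv (y : ℝ) : HasDerivAt
      (fun y : ℝ => (crossKernel a' a x y + crossKernel a a' x y) *
        Complex.exp (-Complex.I * p * y))
      (1 / 2 * (crossKernel a'' a x y - crossKernel a a'' x y) * Complex.exp (-Complex.I * p * y) +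
        -Complex.I * p * ((crossKernel a' a x y + crossKernel a a' x y) *
          Complex.exp (-Complex.I * p * y))) y := by
    have h : HasDerivAt (fun y : ℝ => -Complex.I * (p : ℂ) * y) (-Complex.I * p * 1) y :=
      Complex.ofRealCLM.hasDerivAt.const_mul _
    refine (((hasDerivAt_crossKernel_right a' a x y).add
      (hasDerivAt_crossKernel_right a a' x y)).mul h.cexp).congr_deriv ?_
    simp only [Pi.add_apply]
    ring
  have hzero := integral_eq_zero_of_hasDerivAt_of_integrable hderiv
    (hint'.add (hint.const_mul _)) hint
  rw [integral_add hint' (hint.const_mul _), integral_const_mul] at hzero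
  linear_combination Complex.I * hzero + (p * ∫ y : ℝ,
    (crossKernel a' a x y + crossKernel a a' x y) * Complex.exp (-Complex.I * p * y)) *
      Complex.I_sq

/-- The Wigner transform of a Schrödinger eigenfunction (with polynomial potential `V`)
satisfies the stationary Wigner equation, with the pseudo-differential operator written
in its local Taylor-expanded form. -/
theorem wigner_of_eigenfunction_satisfies_stationary_wigner_equation
    (V : Polynomial ℝ) (E : ℝ) (ψ : SchwartzMap ℝ ℂ)
    (hψ : ∀ x : ℝ,
      -(1/2 : ℂ) * deriv (deriv (ψ : ℝ → ℂ)) x + ((V.eval x : ℝ) : ℂ) * ψ x = (E : ℂ) * ψ x)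
    (f : ℝ → ℝ → ℂ)
    (hf : ∀ x p : ℝ, f x p = (1 / (2 * Real.pi) : ℂ) *
      ∫ y : ℝ, (starRingEnd ℂ) (ψ (x + y / 2)) * ψ (x - y / 2) *
        Complex.exp (-Complex.I * p * y)) :
    ∀ x p : ℝ, (p : ℂ) * deriv (fun x' : ℝ => f x' p) x
      = ∑ m ∈ Finset.range (V.natDegree + 1),
          (1 / ((((2 * m + 1).factorial : ℕ) : ℂ) * (-4 : ℂ) ^ m)) *
            (((Polynomial.derivative^[2 * m + 1] V).eval x : ℝ) : ℂ) *
            iteratedDeriv (2 * m + 1) (fun q : ℝ => f x q) p := by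
  intro x p
  have hψ' (u : ℝ) : schwartzDeriv (schwartzDeriv ψ) u =
      2 * (((V.eval u : ℝ) : ℂ) - E) * ψ u := by
    have h : schwartzDeriv (schwartzDeriv ψ) u = deriv (deriv ψ) u := rfl
    rw [h]
    linear_combination (-2) * hψ u
  have hf' (x p : ℝ) : f x p = (1 / (2 * Real.pi) : ℂ) *
      ∫ y : ℝ, crossKernel ψ ψ x y * Complex.exp (-Complex.I * p * y) := hf x p
  have hpotential (y : ℝ) : 1 / 2 * (crossKernel (schwartzDeriv (schwartzDeriv ψ)) ψ x y -
      crossKernel ψ (schwartzDeriv (schwartzDeriv ψ)) x y) =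
        ((V.eval (x + y / 2) - V.eval (x - y / 2) : ℝ) : ℂ) * crossKernel ψ ψ x y := by
    simp only [crossKernel, hψ', map_mul, map_sub, Complex.conj_ofReal, map_ofNat]
    push_cast
    ring
  have hI (m : ℕ) : (-Complex.I) ^ (2 * m + 1) = -Complex.I * (-1) ^ m := by
    rw [pow_succ, pow_mul, neg_sq, Complex.I_sq, mul_comm]
  have hterm (m : ℕ) (y : ℝ) :
      -Complex.I * (((Polynomial.derivative^[2 * m + 1] V).eval x /
        ((2 * m + 1).factorial * 4 ^ m) * y ^ (2 * m + 1) : ℝ) : ℂ) =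
      (1 / ((((2 * m + 1).factorial : ℕ) : ℂ) * (-4 : ℂ) ^ m)) *
        (((Polynomial.derivative^[2 * m + 1] V).eval x : ℝ) : ℂ) *
          (-Complex.I * y) ^ (2 * m + 1) := by
    have hfac : (((2 * m + 1).factorial : ℕ) : ℂ) ≠ 0 :=
      Nat.cast_ne_zero.2 (Nat.factorial_ne_zero _)
    have hsign : ((-1 : ℂ) ^ m) ^ 2 = 1 := by
      rw [← pow_mul, mul_comm, pow_mul, neg_one_sq, one_pow]
    rw [mul_pow, hI, show (-4 : ℂ) = -1 * 4 by norm_num, mul_pow]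
    push_cast
    field_simp
  simp only [hf', iteratedDeriv_const_mul_field, iteratedDeriv_integral_crossKernel]
  rw [((hasDerivAt_integral_crossKernel ψ ψ x p).const_mul _).deriv, mul_left_comm,
    mul_integral_crossKernel_deriv]
  simp only [mul_left_comm _ (1 / (2 * Real.pi : ℂ)), ← Finset.mul_sum]
  congr 1
  simp only [hpotential, V.eval_add_half_sub_eval_sub_half, ← integral_const_mul]
  rw [← integral_finsetSum _ fun m _ => (integrable_pow_mul_crossKernel ψ ψ x p _).const_mul _]
  congr 1
  ext y
  simp only [← mul_assoc, Complex.ofReal_sum, Finset.mul_sum, hterm, Finset.sum_mul]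
end

section
/- Let V be a polynomial with real coefficients, let Eᵢ, Eⱼ ∈ ℝ, and let ψᵢ, ψⱼ : ℝ → ℂ be Schwartz functions satisfying −(1/2)ψᵢ'' + Vψᵢ = Eᵢψᵢ and −(1/2)ψⱼ'' + Vψⱼ = Eⱼψⱼ on ℝ. Define the cross-Wigner function f_{ij}(x,p) = (1/(2π)) ∫_ℝ conj(ψᵢ(x + y/2)) ψⱼ(x − y/2) e^{−i p y} dy. Then f_{ij} is an eigenfunction of the Wigner energy operator with eigenvalue (Eᵢ + Eⱼ)/2: for all (x,p) ∈ ℝ², (1/2) · ( −(1/4) ∂²f_{ij}/∂x²(x,p) + p² f_{ij}(x,p) + Σ_{m ≥ 0} (2/((2m)! · (−4)^m)) · V^{(2m)}(x) · ∂^{2m}f_{ij}/∂p^{2m}(x,p) ) = ((Eᵢ + Eⱼ)/2) · f_{ij}(x,p). -/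
open MeasureTheory

open SchwartzMap FourierTransform in
/-- The Fourier integral in angular frequency, without normalisation, as a rescaled `𝓕`. -/
lemma integral_mul_exp_eq_fourier (g : ℝ → ℂ) (p : ℝ) :
    ∫ y : ℝ, g y * Complex.exp (-Complex.I * p * y) = 𝓕 g ((2 * Real.pi)⁻¹ * p) := by
  rw [Real.fourier_real_eq_integral_exp_smul]
  refine integral_congr_ae (.of_forall fun y => ?_)
  have hpi : (Real.pi : ℂ) ≠ 0 := by exact_mod_cast Real.pi_ne_zero
  simp only [smul_eq_mul]
  rw [mul_comm]
  congr 2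
  push_cast
  field_simp

open SchwartzMap FourierTransform in
/-- Multiplication by `I p` corresponds to differentiating the integrand. -/
lemma integral_deriv_mul_exp (g : 𝓢(ℝ, ℂ)) (p : ℝ) :
    ∫ y : ℝ, deriv g y * Complex.exp (-Complex.I * p * y)
      = Complex.I * p * ∫ y : ℝ, g y * Complex.exp (-Complex.I * p * y) := by
  rw [integral_mul_exp_eq_fourier, integral_mul_exp_eq_fourier,
    Real.fourier_deriv g.integrable g.differentiable
      (derivCLM ℂ ℂ g).integrable]
  have hpi : (Real.pi : ℂ) ≠ 0 := by exact_mod_cast Real.pi_ne_zero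
  simp only [smul_eq_mul]
  push_cast
  field_simp

open SchwartzMap in
/-- Schwartz functions are integrable against every power. -/
lemma SchwartzMap.integrable_pow_smul (g : 𝓢(ℝ, ℂ)) (n : ℕ) :
    Integrable (fun y : ℝ => y ^ n • g y) := by
  refine (g.integrable_pow_mul volume n).mono' (by fun_prop) (.of_forall fun y => ?_)
  simp

open SchwartzMap FourierTransform in
/-- Differentiating in the frequency multiplies the integrand by `-I y`. -/
lemma iteratedDeriv_integral_mul_exp (g : 𝓢(ℝ, ℂ)) (n : ℕ) (p : ℝ) :
    iteratedDeriv n (fun q : ℝ => ∫ y : ℝ, g y * Complex.exp (-Complex.I * q * y)) p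
      = ∫ y : ℝ, ((-Complex.I * y) ^ n * g y) * Complex.exp (-Complex.I * p * y) := by
  have hc : ContDiff ℝ n (𝓕 (g : ℝ → ℂ)) := by
    rw [← fourier_coe]
    exact (𝓕 g).smooth n
  rw [funext fun q => integral_mul_exp_eq_fourier g q, iteratedDeriv_comp_const_smul hc,
    Real.iteratedDeriv_fourier (N := ⊤) (fun k _ => g.integrable_pow_smul k) le_top,
    integral_mul_exp_eq_fourier]
  simp only [Real.fourier_real_eq_integral_exp_smul]
  rw [← integral_smul]
  refine integral_congr_ae (.of_forall fun y => ?_)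
  have hpi : (Real.pi : ℂ) ≠ 0 := by exact_mod_cast Real.pi_ne_zero
  have h : (-Complex.I * y) ^ n
      = ((((2 * Real.pi)⁻¹ : ℝ) : ℂ)) ^ n * (-2 * Real.pi * Complex.I * y) ^ n := by
    rw [← mul_pow]
    congr 1
    push_cast
    field_simp
  simp only [smul_eq_mul, Complex.real_smul, h]
  push_cast
  ring

open SchwartzMap in
/-- The integrand `y ↦ A (x + y / 2) * B (x - y / 2)` of the Wigner transform is Schwartz. -/
lemma exists_schwartzMap_shift_mul (A B : 𝓢(ℝ, ℂ)) (x : ℝ) :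
    ∃ g : 𝓢(ℝ, ℂ), ∀ y, g y = A (x + y / 2) * B (x - y / 2) := by
  have h1 : (fun y : ℝ => x + y / 2).HasTemperateGrowth := by
    simp only [div_eq_mul_inv]; fun_prop
  have h2 : (fun y : ℝ => x - y / 2).HasTemperateGrowth := by
    simp only [div_eq_mul_inv]; fun_prop
  have a1 : AntilipschitzWith 2 (fun y : ℝ => x + y / 2) :=
    AntilipschitzWith.of_le_mul_dist fun y z => by
      simp only [Real.dist_eq, NNReal.coe_ofNat]
      rw [show x + y / 2 - (x + z / 2) = (y - z) / 2 by ring, abs_div, abs_two]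
      linarith
  have a2 : AntilipschitzWith 2 (fun y : ℝ => x - y / 2) :=
    AntilipschitzWith.of_le_mul_dist fun y z => by
      simp only [Real.dist_eq, NNReal.coe_ofNat]
      rw [show x - y / 2 - (x - z / 2) = -(y - z) / 2 by ring, abs_div, abs_two, abs_neg]
      linarith
  exact ⟨pairing (ContinuousLinearMap.mul ℂ ℂ) (compCLMOfAntilipschitz ℂ h1 a1 A)
    (compCLMOfAntilipschitz ℂ h2 a2 B), fun y => rfl⟩

/-- The unnormalised Wigner transform `∫ A (x + y / 2) B (x - y / 2) exp (-I p y) dy`. -/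
noncomputable def wignerIntegral (A B : ℝ → ℂ) (x p : ℝ) : ℂ :=
  ∫ y : ℝ, A (x + y / 2) * B (x - y / 2) * Complex.exp (-Complex.I * p * y)

open SchwartzMap in
lemma SchwartzMap.integrable_mul_exp (g : 𝓢(ℝ, ℂ)) (p : ℝ) :
    Integrable (fun y : ℝ => g y * Complex.exp (-Complex.I * p * y)) := by
  refine g.integrable.norm.mono' (by fun_prop) (.of_forall fun y => ?_)
  rw [norm_mul, norm_exp_neg_I_mul, mul_one]

open SchwartzMap in
lemma integrable_wigner (A B : 𝓢(ℝ, ℂ)) (x p : ℝ) :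
    Integrable (fun y : ℝ =>
      A (x + y / 2) * B (x - y / 2) * Complex.exp (-Complex.I * p * y)) := by
  obtain ⟨g, hg⟩ := exists_schwartzMap_shift_mul A B x
  simpa only [hg] using g.integrable_mul_exp p

open SchwartzMap in
/-- A product `A (x + y / 2) * B (x - y / 2)` decays in `y` locally uniformly in `x`. -/
lemma exists_norm_shift_mul_le (A B : 𝓢(ℝ, ℂ)) (x₀ : ℝ) :
    ∃ C : ℝ, ∀ x ∈ Metric.ball x₀ 1, ∀ y : ℝ,
      ‖A (x + y / 2) * B (x - y / 2)‖ ≤ C * (1 + (y / 2) ^ 2)⁻¹ := by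
  obtain ⟨a, ha0, ha⟩ := A.decay 0 0
  obtain ⟨b, hb0, hb⟩ := B.decay 0 0
  obtain ⟨c, hc0, hc⟩ := B.decay 2 0
  simp only [norm_iteratedFDeriv_zero, pow_zero, one_mul, Real.norm_eq_abs, sq_abs] at ha hb hc
  refine ⟨a * ((1 + 2 * (|x₀| + 1) ^ 2) * b + 2 * c), fun x hx y => ?_⟩
  have hx' : |x| ≤ |x₀| + 1 := by
    have h1 := abs_sub_abs_le_abs_sub x x₀
    have h2 : |x - x₀| < 1 := by simpa [Real.dist_eq] using hx
    linarith
  have hxx : x ^ 2 ≤ (|x₀| + 1) ^ 2 := by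
    rw [← sq_abs]; gcongr
  have hB : ‖B (x - y / 2)‖ * (1 + (y / 2) ^ 2) ≤ (1 + 2 * (|x₀| + 1) ^ 2) * b + 2 * c := by
    have hn := norm_nonneg (B (x - y / 2))
    have h1 : 1 + (y / 2) ^ 2 ≤ (1 + 2 * (|x₀| + 1) ^ 2) + 2 * (x - y / 2) ^ 2 := by
      nlinarith [sq_nonneg (x + (x - y / 2))]
    have h2 := mul_le_mul_of_nonneg_left h1 hn
    have h3 := mul_le_mul_of_nonneg_left (hb (x - y / 2))
      (by positivity : 0 ≤ 1 + 2 * (|x₀| + 1) ^ 2)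
    have h4 := hc (x - y / 2)
    nlinarith
  rw [norm_mul, ← div_eq_mul_inv, le_div_iff₀ (by positivity), mul_assoc]
  exact mul_le_mul (ha _) hB (by positivity) ha0.le

open SchwartzMap in
/-- The Leibniz rule for the position derivative of the Wigner transform. -/
lemma hasDerivAt_wignerIntegral (A B : 𝓢(ℝ, ℂ)) (x p : ℝ) :
    HasDerivAt (fun x' => wignerIntegral A B x' p)
      (wignerIntegral (deriv A) B x p + wignerIntegral A (deriv B) x p) x := by
  have hA : (deriv A : ℝ → ℂ) = derivCLM ℂ ℂ A := rfl
  have hB : (deriv B : ℝ → ℂ) = derivCLM ℂ ℂ B := rfl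
  obtain ⟨C, hC⟩ := exists_norm_shift_mul_le (derivCLM ℂ ℂ A) B x
  obtain ⟨D, hD⟩ := exists_norm_shift_mul_le A (derivCLM ℂ ℂ B) x
  have hi1 := integrable_wigner (derivCLM ℂ ℂ A) B x p
  have hi2 := integrable_wigner A (derivCLM ℂ ℂ B) x p
  have hint : Integrable (fun y : ℝ => (C + D) * (1 + (y / 2) ^ 2)⁻¹) :=
    (integrable_inv_one_add_sq.comp_div two_ne_zero).const_mul _
  rw [hA, hB, wignerIntegral, wignerIntegral, ← integral_add hi1 hi2]
  refine (hasDerivAt_integral_of_dominated_loc_of_deriv_le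
    (F := fun x' y => A (x' + y / 2) * B (x' - y / 2) * Complex.exp (-Complex.I * p * y))
    (F' := fun x' y =>
      derivCLM ℂ ℂ A (x' + y / 2) * B (x' - y / 2) * Complex.exp (-Complex.I * p * y)
      + A (x' + y / 2) * derivCLM ℂ ℂ B (x' - y / 2) * Complex.exp (-Complex.I * p * y))
    (Metric.ball_mem_nhds x one_pos)
    (.of_forall fun x' => (integrable_wigner A B x' p).aestronglyMeasurable)
    (integrable_wigner A B x p) (hi1.add hi2).aestronglyMeasurable
    (.of_forall fun y x' hx' => ?_) hint (.of_forall fun y x' _ => ?_)).2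
  · refine (norm_add_le _ _).trans ?_
    rw [norm_mul _ (Complex.exp _), norm_mul _ (Complex.exp _), norm_exp_neg_I_mul,
      mul_one, mul_one, add_mul]
    exact add_le_add (hC x' hx' y) (hD x' hx' y)
  · have h1 := (A.hasDerivAt (x' + y / 2)).comp_add_const x' (y / 2)
    have h2 := (B.hasDerivAt (x' - y / 2)).comp_sub_const x' (y / 2)
    refine ((h1.mul h2).mul_const (Complex.exp (-Complex.I * p * y))).congr_deriv ?_
    simp only [derivCLM_apply]
    ring

open SchwartzMap in
/-- Multiplication of the Wigner transform by the momentum. -/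
lemma I_mul_wignerIntegral (A B : 𝓢(ℝ, ℂ)) (x p : ℝ) :
    Complex.I * p * wignerIntegral A B x p
      = (1 / 2) * (wignerIntegral (deriv A) B x p - wignerIntegral A (deriv B) x p) := by
  obtain ⟨g, hg⟩ := exists_schwartzMap_shift_mul A B x
  have hi1 := integrable_wigner (derivCLM ℂ ℂ A) B x p
  have hi2 := integrable_wigner A (derivCLM ℂ ℂ B) x p
  have hA : (deriv A : ℝ → ℂ) = derivCLM ℂ ℂ A := rfl
  have hB : (deriv B : ℝ → ℂ) = derivCLM ℂ ℂ B := rfl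
  have hgd (y : ℝ) : deriv g y = (1 / 2) * (deriv A (x + y / 2) * B (x - y / 2)
      - A (x + y / 2) * deriv B (x - y / 2)) := by
    have hy : HasDerivAt (fun y : ℝ => y / 2) (1 / 2) y := (hasDerivAt_id y).div_const 2
    have h1 := (A.hasDerivAt (x + y / 2)).scomp y (hy.const_add x)
    have h2 := (B.hasDerivAt (x - y / 2)).scomp y (hy.const_sub x)
    rw [show (g : ℝ → ℂ) = fun y => A (x + y / 2) * B (x - y / 2) from funext hg]
    refine (h1.mul h2).deriv.trans ?_
    simp only [Function.comp, Complex.real_smul]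
    push_cast
    ring
  have h := integral_deriv_mul_exp g p
  simp only [hg] at h
  rw [wignerIntegral, ← h, hA, hB, wignerIntegral, wignerIntegral, ← integral_sub hi1 hi2,
    ← integral_const_mul]
  refine integral_congr_ae (.of_forall fun y => ?_)
  simp only [hgd, derivCLM_apply]
  ring

open Polynomial in
/-- The even part of the Taylor expansion of a polynomial about `x`. -/
lemma Polynomial.sum_even_iterate_derivative (V : ℝ[X]) (x h : ℝ) :
    ∑ m ∈ Finset.range (V.natDegree + 1),
        2 / ((2 * m).factorial : ℝ) * (derivative^[2 * m] V).eval x * h ^ (2 * m)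
      = V.eval (x + h) + V.eval (x - h) := by
  have key (t : ℝ) : V.eval (x + t)
      = ∑ n ∈ Finset.range (2 * (V.natDegree + 1)),
          ((derivative^[n] V).eval x / (n.factorial : ℝ)) * t ^ n := by
    rw [add_comm, ← taylor_eval, eval_eq_sum_range' (n := 2 * (V.natDegree + 1))
      (by rw [natDegree_taylor]; omega)]
    refine Finset.sum_congr rfl fun n _ => ?_
    rw [taylor_coeff, ← factorial_smul_hasseDeriv]
    have hn : (n.factorial : ℝ) ≠ 0 := by positivity
    simp [hn]
  rw [sub_eq_add_neg, key, key, ← Finset.sum_add_distrib]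
  generalize V.natDegree + 1 = N
  induction N with
  | zero => simp
  | succ N ih =>
    rw [Finset.sum_range_succ, ih, show 2 * (N + 1) = 2 * N + 1 + 1 by ring,
      Finset.sum_range_succ _ (2 * N + 1), Finset.sum_range_succ _ (2 * N),
      (even_two_mul N).neg_pow, (odd_two_mul_add_one N).neg_pow]
    ring

open SchwartzMap in
/-- The Moyal series of a polynomial potential acts on the Wigner integrand as multiplication
by `V (x + y / 2) + V (x - y / 2)`. -/
lemma sum_moyal_wignerIntegral (V : Polynomial ℝ) (A B : 𝓢(ℝ, ℂ)) (x p : ℝ) :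
    ∑ m ∈ Finset.range (V.natDegree + 1),
      (2 / ((((2 * m).factorial : ℕ) : ℂ) * (-4 : ℂ) ^ m)) *
        (((Polynomial.derivative^[2 * m] V).eval x : ℝ) : ℂ) *
        iteratedDeriv (2 * m) (fun q : ℝ => wignerIntegral A B x q) p
      = ∫ y : ℝ, ((V.eval (x + y / 2) + V.eval (x - y / 2) : ℝ) : ℂ) *
          (A (x + y / 2) * B (x - y / 2) * Complex.exp (-Complex.I * p * y)) := by
  obtain ⟨g, hg⟩ := exists_schwartzMap_shift_mul A B x
  simp only [wignerIntegral, ← hg, iteratedDeriv_integral_mul_exp, ← integral_const_mul]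
  rw [← integral_finsetSum]
  · refine integral_congr_ae (.of_forall fun y => ?_)
    simp only [← V.sum_even_iterate_derivative]
    push_cast
    rw [Finset.sum_mul]
    refine Finset.sum_congr rfl fun m _ => ?_
    have h : (-Complex.I * y) ^ (2 * m) = (-4) ^ m * (y / 2 : ℂ) ^ (2 * m) := by
      rw [pow_mul, pow_mul, ← mul_pow]
      congr 1
      rw [mul_pow, neg_sq, Complex.I_sq]
      ring
    have h4 : (-4 : ℂ) ^ m ≠ 0 := by simp
    have hm : (((2 * m).factorial : ℕ) : ℂ) ≠ 0 := by exact_mod_cast (2 * m).factorial_ne_zero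
    rw [h]
    field_simp
  · intro m _
    refine Integrable.const_mul ?_ _
    refine (g.integrable_pow_smul (2 * m)).norm.mono' (by fun_prop) (.of_forall fun y => ?_)
    rw [norm_mul, norm_exp_neg_I_mul, mul_one]
    simp

open SchwartzMap in
/-- The Wigner energy operator applied to the unnormalised cross-Wigner transform of two
Schrödinger eigenfunctions. -/
lemma wignerEnergy_wignerIntegral (V : Polynomial ℝ) (a b : ℂ) (A B : 𝓢(ℝ, ℂ))
    (hA : ∀ x : ℝ, -(1/2 : ℂ) * deriv (deriv A) x + ((V.eval x : ℝ) : ℂ) * A x = a * A x)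
    (hB : ∀ x : ℝ, -(1/2 : ℂ) * deriv (deriv B) x + ((V.eval x : ℝ) : ℂ) * B x = b * B x)
    (x p : ℝ) :
    -(1/4 : ℂ) * deriv (deriv (fun x' : ℝ => wignerIntegral A B x' p)) x
        + (p : ℂ) ^ 2 * wignerIntegral A B x p
        + ∑ m ∈ Finset.range (V.natDegree + 1),
            (2 / ((((2 * m).factorial : ℕ) : ℂ) * (-4 : ℂ) ^ m)) *
              (((Polynomial.derivative^[2 * m] V).eval x : ℝ) : ℂ) *
              iteratedDeriv (2 * m) (fun q : ℝ => wignerIntegral A B x q) p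
      = (a + b) * wignerIntegral A B x p := by
  set A' := derivCLM ℂ ℂ A
  set B' := derivCLM ℂ ℂ B
  have eA : deriv A = A' := rfl
  have eB : deriv B = B' := rfl
  have eA' : deriv A' = derivCLM ℂ ℂ A' := rfl
  have eB' : deriv B' = derivCLM ℂ ℂ B' := rfl
  have d2 : deriv (deriv (fun x' : ℝ => wignerIntegral A B x' p)) x
      = wignerIntegral (deriv A') B x p + 2 * wignerIntegral A' B' x p
        + wignerIntegral A (deriv B') x p := by
    rw [show deriv (fun x' : ℝ => wignerIntegral A B x' p)
      = fun x' => wignerIntegral A' B x' p + wignerIntegral A B' x' p from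
      funext fun x' => (hasDerivAt_wignerIntegral A B x' p).deriv]
    refine ((hasDerivAt_wignerIntegral A' B x p).add
      (hasDerivAt_wignerIntegral A B' x p)).deriv.trans ?_
    rw [eA, eB]
    ring
  have hp : (p : ℂ) ^ 2 * wignerIntegral A B x p
      = -(1 / 4) * (wignerIntegral (deriv A') B x p - 2 * wignerIntegral A' B' x p
        + wignerIntegral A (deriv B') x p) := by
    have h0 := I_mul_wignerIntegral A B x p
    have h1 := I_mul_wignerIntegral A' B x p
    have h2 := I_mul_wignerIntegral A B' x p
    rw [eA, eB] at h0
    rw [eB] at h1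
    rw [eA] at h2
    linear_combination (-(Complex.I * p)) * h0 - (1 / 2) * h1 + (1 / 2) * h2
      + (p : ℂ) ^ 2 * wignerIntegral A B x p * Complex.I_sq
  have hV : ∫ y : ℝ, ((V.eval (x + y / 2) + V.eval (x - y / 2) : ℝ) : ℂ) *
        (A (x + y / 2) * B (x - y / 2) * Complex.exp (-Complex.I * p * y))
      = (a + b) * wignerIntegral A B x p + (1 / 2) * (wignerIntegral (deriv A') B x p
        + wignerIntegral A (deriv B') x p) := by
    have i0 := integrable_wigner A B x p
    have i1 := integrable_wigner (derivCLM ℂ ℂ A') B x p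
    have i2 := integrable_wigner A (derivCLM ℂ ℂ B') x p
    rw [eA', eB', wignerIntegral, wignerIntegral, wignerIntegral, ← integral_add i1 i2,
      ← integral_const_mul, ← integral_const_mul,
      ← integral_add (i0.const_mul _) (by exact (i1.add i2).const_mul _)]
    refine integral_congr_ae (.of_forall fun y => ?_)
    have h1 := hA (x + y / 2)
    have h2 := hB (x - y / 2)
    rw [eA, eA'] at h1
    rw [eB, eB'] at h2
    simp only
    push_cast
    linear_combination (B (x - y / 2) * Complex.exp (-Complex.I * p * y)) * h1
      + (A (x + y / 2) * Complex.exp (-Complex.I * p * y)) * h2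
  rw [d2, hp, sum_moyal_wignerIntegral, hV]
  ring

/-- The cross-Wigner transform of two Schrödinger eigenfunctions with energies `Eᵢ`, `Eⱼ`
(polynomial potential `V`) is an eigenfunction of the Wigner energy operator with
eigenvalue `(Eᵢ + Eⱼ)/2`. -/
theorem crossWigner_eigenfunction_of_wigner_energy_operator
    (V : Polynomial ℝ) (Ei Ej : ℝ) (ψi ψj : SchwartzMap ℝ ℂ)
    (hi : ∀ x : ℝ,
      -(1/2 : ℂ) * deriv (deriv (ψi : ℝ → ℂ)) x + ((V.eval x : ℝ) : ℂ) * ψi x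
        = (Ei : ℂ) * ψi x)
    (hj : ∀ x : ℝ,
      -(1/2 : ℂ) * deriv (deriv (ψj : ℝ → ℂ)) x + ((V.eval x : ℝ) : ℂ) * ψj x
        = (Ej : ℂ) * ψj x)
    (f : ℝ → ℝ → ℂ)
    (hf : ∀ x p : ℝ, f x p = (1 / (2 * Real.pi) : ℂ) *
      ∫ y : ℝ, (starRingEnd ℂ) (ψi (x + y / 2)) * ψj (x - y / 2) *
        Complex.exp (-Complex.I * p * y)) :
    ∀ x p : ℝ,
      (1/2 : ℂ) * (-(1/4 : ℂ) * deriv (deriv (fun x' : ℝ => f x' p)) x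
        + (p : ℂ) ^ 2 * f x p
        + ∑ m ∈ Finset.range (V.natDegree + 1),
            (2 / ((((2 * m).factorial : ℕ) : ℂ) * (-4 : ℂ) ^ m)) *
              (((Polynomial.derivative^[2 * m] V).eval x : ℝ) : ℂ) *
              iteratedDeriv (2 * m) (fun q : ℝ => f x q) p)
      = (((Ei + Ej) / 2 : ℝ) : ℂ) * f x p := by
  intro x p
  set A : SchwartzMap ℝ ℂ :=
    (ψi.postcompCLM (Complex.conjCLE : ℂ →L[ℝ] ℂ) : SchwartzMap ℝ ℂ)
  have hAapp (y : ℝ) : A y = (starRingEnd ℂ) (ψi y) := rfl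
  have hAd : deriv A = fun y => (starRingEnd ℂ) (deriv ψi y) :=
    funext fun y => (ψi.hasDerivAt y).star.deriv
  have hAdd (y : ℝ) : deriv (deriv A) y = (starRingEnd ℂ) (deriv (deriv ψi) y) := by
    rw [hAd]
    exact ((SchwartzMap.derivCLM ℂ ℂ ψi).hasDerivAt y).star.deriv
  have hA (y : ℝ) : -(1/2 : ℂ) * deriv (deriv A) y + ((V.eval y : ℝ) : ℂ) * A y
      = (Ei : ℂ) * A y := by
    simpa [hAdd, hAapp, Complex.conj_ofNat] using congrArg (starRingEnd ℂ) (hi y)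
  have hf' : f = fun x p => (1 / (2 * Real.pi) : ℂ) * wignerIntegral A ψj x p :=
    funext fun x => funext fun p => hf x p
  have key := wignerEnergy_wignerIntegral V Ei Ej A ψj hA hj x p
  have hd : deriv (deriv fun x' : ℝ => (1 / (2 * Real.pi) : ℂ) * wignerIntegral A ψj x' p) x
      = (1 / (2 * Real.pi) : ℂ) * deriv (deriv fun x' : ℝ => wignerIntegral A ψj x' p) x := by
    simp only [deriv_const_mul_field']
  simp only [hf', hd, iteratedDeriv_const_mul_field]
  simp only [mul_left_comm _ (1 / (2 * Real.pi) : ℂ), ← Finset.mul_sum, ← mul_add]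
  rw [key]
  push_cast
  ring
end

section
/- For every natural number n, the integral ∫_ℝ He_n(x) · e^{−x²} dx equals (−1/4)^{n/2} · (n! / (n/2)!) · √π when n is even, and equals 0 when n is odd, where He_n denotes the probabilists' Hermite polynomial. -/
open MeasureTheory

theorem Polynomial.derivative_hermite_succ (n : ℕ) :
    derivative (hermite (n + 1)) = (n + 1 : Polynomial ℤ) * hermite n := by
  induction n with
  | zero => simp
  | succ n ih =>
    rw [hermite_succ (n + 1), derivative_sub, derivative_mul, ih, derivative_X, derivative_mul,
      hermite_succ n]
    simp only [derivative_add, derivative_natCast, derivative_one]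
    push_cast
    ring

theorem integrable_aeval_mul_exp_neg_sq {R : Type*} [CommSemiring R] [Algebra R ℝ]
    (p : Polynomial R) :
    Integrable fun x : ℝ => (Polynomial.aeval x p : ℝ) * Real.exp (-x ^ 2) := by
  simp only [Polynomial.aeval_eq_sum_range, Finset.sum_mul]
  refine integrable_finsetSum _ fun i _ => ?_
  have h := integrable_rpow_mul_exp_neg_mul_sq one_pos (s := (i : ℝ))
    (by linarith [(Nat.cast_nonneg i : (0 : ℝ) ≤ i)])
  simp only [Real.rpow_natCast, neg_mul, one_mul] at h
  simpa only [Algebra.smul_def, mul_assoc] using h.const_mul (algebraMap R ℝ (p.coeff i))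

theorem integral_aeval_X_mul_mul_exp_neg_sq {R : Type*} [CommSemiring R] [Algebra R ℝ]
    (p : Polynomial R) :
    2 * ∫ x : ℝ, (Polynomial.aeval x (Polynomial.X * p) : ℝ) * Real.exp (-x ^ 2) =
      ∫ x : ℝ, (Polynomial.aeval x (Polynomial.derivative p) : ℝ) * Real.exp (-x ^ 2) := by
  have hd := integrable_aeval_mul_exp_neg_sq (Polynomial.derivative p)
  have hX := (integrable_aeval_mul_exp_neg_sq (Polynomial.X * p)).const_mul 2
  have key := integral_eq_zero_of_hasDerivAt_of_integrable
    (f := fun x : ℝ => (Polynomial.aeval x p : ℝ) * Real.exp (-x ^ 2))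
    (f' := fun x : ℝ => (Polynomial.aeval x (Polynomial.derivative p) : ℝ) * Real.exp (-x ^ 2) -
      2 * ((Polynomial.aeval x (Polynomial.X * p) : ℝ) * Real.exp (-x ^ 2)))
    (fun x => ((p.hasDerivAt_aeval x).mul (hasDerivAt_pow 2 x).neg.exp).congr_deriv (by
      simp only [map_mul, Polynomial.aeval_X, Pi.neg_apply]
      push_cast
      ring))
    (hd.sub hX) (integrable_aeval_mul_exp_neg_sq p)
  rw [integral_sub hd hX, integral_const_mul] at key
  linarith

theorem integral_hermite_add_two_mul_exp_neg_sq (n : ℕ) :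
    ∫ x : ℝ, (Polynomial.aeval x (Polynomial.hermite (n + 2)) : ℝ) * Real.exp (-x ^ 2) =
      -((n + 1 : ℝ) / 2) *
        ∫ x : ℝ, (Polynomial.aeval x (Polynomial.hermite n) : ℝ) * Real.exp (-x ^ 2) := by
  have h := integral_aeval_X_mul_mul_exp_neg_sq (Polynomial.hermite (n + 1))
  have hd : ∫ x : ℝ, (Polynomial.aeval x
        (Polynomial.derivative (Polynomial.hermite (n + 1))) : ℝ) * Real.exp (-x ^ 2) =
      (n + 1 : ℝ) *
        ∫ x : ℝ, (Polynomial.aeval x (Polynomial.hermite n) : ℝ) * Real.exp (-x ^ 2) := by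
    simp only [Polynomial.derivative_hermite_succ, map_mul, map_add, map_natCast, map_one,
      mul_assoc, integral_const_mul]
  rw [Polynomial.hermite_succ (n + 1)]
  simp only [map_sub, sub_mul]
  rw [integral_sub (integrable_aeval_mul_exp_neg_sq _) (integrable_aeval_mul_exp_neg_sq _)]
  linarith

/-- `∫ He_n(x) e^{-x²} dx = (-1/4)^{n/2} (n!/(n/2)!) √π` for even `n`, and `0` for odd `n`,
where `He_n` is the probabilists' Hermite polynomial. -/
theorem integral_hermite_mul_exp_neg_sq (n : ℕ) :
    ∫ x : ℝ, (Polynomial.aeval x (Polynomial.hermite n) : ℝ) * Real.exp (-x ^ 2)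
      = if Even n then
          (-(1/4) : ℝ) ^ (n / 2) * ((n.factorial : ℝ) / ((n / 2).factorial : ℝ)) *
            Real.sqrt Real.pi
        else 0 := by
  induction n using Nat.twoStepInduction with
  | zero => simpa using integral_gaussian 1
  | one =>
    have h := integral_aeval_X_mul_mul_exp_neg_sq (1 : Polynomial ℤ)
    simpa using h
  | more n ih _ =>
    rw [integral_hermite_add_two_mul_exp_neg_sq, ih]
    by_cases hn : Even n
    · obtain ⟨m, rfl⟩ := hn.exists_two_nsmul
      have hm : (2 * m + 2) / 2 = m + 1 := by lia
      have hfac : (m.factorial : ℝ) ≠ 0 := by positivity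
      have hm0 : (m + 1 : ℝ) ≠ 0 := by positivity
      simp only [smul_eq_mul, hm, Nat.factorial_succ, pow_succ, Nat.even_add, even_two_mul,
        even_two, if_true, Nat.mul_div_cancel_left m two_pos]
      push_cast
      field_simp
      ring
    · simp [Nat.even_add, hn]
end

section
/- For every natural number n and every c ∈ ℝ, ∫_ℝ He_n(p) · e^{−p²/2} · e^{i p c} dp = √(2π) · (i c)^n · e^{−c²/2}, where He_n denotes the probabilists' Hermite polynomial and the integral is taken of a complex-valued function of the real variable p. -/
open MeasureTheory

/-- A real polynomial times the Gaussian weight is integrable. -/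
lemma integrable_aeval_mul_exp_neg_sq_div_two (P : Polynomial ℤ) :
    Integrable (fun p : ℝ => (Polynomial.aeval p P : ℝ) * Real.exp (-p ^ 2 / 2)) := by
  induction P using Polynomial.induction_on' with
  | add P Q hP hQ =>
    refine (hP.add hQ).congr (Filter.Eventually.of_forall fun p => ?_)
    simp [add_mul]
  | monomial n a =>
    have h := integrable_rpow_mul_exp_neg_mul_sq (b := 1 / 2) (by norm_num)
      (s := (n : ℝ)) (by linarith [Nat.cast_nonneg (α := ℝ) n])
    refine (h.const_mul (a : ℝ)).congr (Filter.Eventually.of_forall fun p => ?_)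
    have hexp : -(1 / 2) * p ^ 2 = -p ^ 2 / 2 := by ring
    simp only [Real.rpow_natCast, Polynomial.aeval_monomial, hexp]
    simp [mul_assoc]

/-- A polynomial times the Gaussian weight times a Fourier character is integrable. -/
lemma integrable_aeval_mul_gaussian_mul_cexp (P : Polynomial ℤ) (c : ℝ) :
    Integrable (fun p : ℝ => ((Polynomial.aeval p P : ℝ) : ℂ) *
      Complex.exp (-(p : ℂ) ^ 2 / 2) * Complex.exp (Complex.I * p * c)) := by
  refine (integrable_aeval_mul_exp_neg_sq_div_two P).mono ?_
    (Filter.Eventually.of_forall fun p => ?_)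
  · have hP : Continuous fun p : ℝ => (Polynomial.aeval p P : ℝ) :=
      Polynomial.continuous_aeval P
    exact Continuous.aestronglyMeasurable (by fun_prop)
  · have hre : (-(p : ℂ) ^ 2 / 2) = ((-p ^ 2 / 2 : ℝ) : ℂ) := by push_cast; ring
    have him : Complex.I * p * c = ((p * c : ℝ) : ℂ) * Complex.I := by push_cast; ring
    rw [norm_mul, norm_mul, hre, him, Complex.norm_exp_ofReal_mul_I, ← Complex.ofReal_exp,
      Complex.norm_real, Complex.norm_real, mul_one, norm_mul]

/-- The derivative of a Hermite–Gaussian function times a Fourier character. -/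
lemma hasDerivAt_hermite_mul_gaussian_mul_cexp (n : ℕ) (c p : ℝ) :
    HasDerivAt (fun p : ℝ => ((Polynomial.aeval p (Polynomial.hermite n) : ℝ) : ℂ) *
        Complex.exp (-(p : ℂ) ^ 2 / 2) * Complex.exp (Complex.I * p * c))
      (Complex.I * c * (((Polynomial.aeval p (Polynomial.hermite n) : ℝ) : ℂ) *
          Complex.exp (-(p : ℂ) ^ 2 / 2) * Complex.exp (Complex.I * p * c)) -
        ((Polynomial.aeval p (Polynomial.hermite (n + 1)) : ℝ) : ℂ) *
          Complex.exp (-(p : ℂ) ^ 2 / 2) * Complex.exp (Complex.I * p * c)) p := by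
  have hid : HasDerivAt (fun p : ℝ => (p : ℂ)) 1 p := Complex.ofRealCLM.hasDerivAt
  have hpoly := (Polynomial.hasDerivAt_aeval (Polynomial.hermite n) p).ofReal_comp
  have hgauss := ((hid.pow 2).neg.div_const 2).cexp
  have hchar := ((hid.const_mul Complex.I).mul_const (c : ℂ)).cexp
  refine ((hpoly.mul hgauss).mul hchar).congr_deriv ?_
  simp only [Polynomial.hermite_succ, map_sub, map_mul, Polynomial.aeval_X, Pi.mul_apply,
    Pi.pow_apply, Pi.neg_apply]
  push_cast
  ring

/-- Fourier-transform identity for Hermite–Gaussian functions: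
`∫ He_n(p) e^{-p²/2} e^{ipc} dp = √(2π) (ic)^n e^{-c²/2}`. -/
theorem integral_hermite_gaussian_fourier (n : ℕ) (c : ℝ) :
    ∫ p : ℝ, ((Polynomial.aeval p (Polynomial.hermite n) : ℝ) : ℂ) *
        Complex.exp (-(p : ℂ) ^ 2 / 2) * Complex.exp (Complex.I * p * c)
      = (Real.sqrt (2 * Real.pi) : ℂ) * (Complex.I * c) ^ n *
          Complex.exp (-(c : ℂ) ^ 2 / 2) := by
  induction n with
  | zero =>
    have h := fourierIntegral_gaussian (b := 1 / 2) (by norm_num) (c : ℂ)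
    have hsqrt : ((Real.pi : ℂ) / (1 / 2)) ^ (1 / 2 : ℂ) = (Real.sqrt (2 * Real.pi) : ℂ) := by
      rw [Real.sqrt_eq_rpow, Complex.ofReal_cpow (by positivity)]
      congr 1 <;> push_cast <;> ring
    have hexp : -(c : ℂ) ^ 2 / (4 * (1 / 2)) = -(c : ℂ) ^ 2 / 2 := by ring
    rw [hsqrt, hexp] at h
    rw [pow_zero, mul_one, ← h]
    refine integral_congr_ae (Filter.Eventually.of_forall fun p => ?_)
    simp only [Polynomial.hermite_zero, map_one, Complex.ofReal_one, one_mul]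
    rw [mul_comm]
    congr 2 <;> ring
  | succ n ih =>
    have hn := integrable_aeval_mul_gaussian_mul_cexp (Polynomial.hermite n) c
    have hn' := integrable_aeval_mul_gaussian_mul_cexp (Polynomial.hermite (n + 1)) c
    have h := integral_eq_zero_of_hasDerivAt_of_integrable
      (hasDerivAt_hermite_mul_gaussian_mul_cexp n c) ((hn.const_mul _).sub hn') hn
    rw [integral_sub (hn.const_mul _) hn', integral_const_mul, ih] at h
    rw [← sub_eq_zero.mp h]
    ring
end

section
/- Let D be a positive natural number, let W be a real vector space, and let f, h : (Fin D → ℕ) → W be families indexed by D-dimensional multi-indices. Suppose that for every multi-index α, h(α) = Σ_{β : 2β ≤ α componentwise} (1/(2^{|β|} · β!)) · f(α − 2β), where |β| = Σ_j β_j and β! = Π_j (β_j)!. Then for every multi-index α, f(α) = Σ_{β : 2β ≤ α componentwise} ((−1)^{|β|}/(2^{|β|} · β!)) · h(α − 2β). -/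
open Finset in
theorem sum_alternating_inv_factorial_mul (c : ℝ) (hc : c ≠ 0) (n : ℕ) :
    ∑ k ∈ Iic n, (-1 : ℝ) ^ k / (c ^ k * (k.factorial : ℝ)) *
      (1 / (c ^ (n - k) * ((n - k).factorial : ℝ))) = if n = 0 then 1 else 0 := by
  have key : ∀ k ∈ Iic n, (-1 : ℝ) ^ k / (c ^ k * (k.factorial : ℝ)) *
      (1 / (c ^ (n - k) * ((n - k).factorial : ℝ))) =
      ((-1 : ℝ) ^ k * (n.choose k : ℝ)) * (1 / (c ^ n * (n.factorial : ℝ))) := by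
    intro k hk
    have hk' : k ≤ n := mem_Iic.mp hk
    have hpow : c ^ n = c ^ k * c ^ (n - k) := by rw [← pow_add, Nat.add_sub_cancel' hk']
    have h1 : (k.factorial : ℝ) ≠ 0 := by positivity
    have h2 : ((n - k).factorial : ℝ) ≠ 0 := by positivity
    have h3 : (n.factorial : ℝ) ≠ 0 := by positivity
    rw [Nat.cast_choose ℝ hk', hpow]
    field_simp
  have halt : ∑ k ∈ Iic n, (-1 : ℝ) ^ k * (n.choose k : ℝ) = if n = 0 then 1 else 0 := by
    have hI : Iic n = range (n + 1) := by ext; simp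
    rw [hI]
    exact_mod_cast Int.alternating_sum_range_choose (n := n)
  rw [sum_congr rfl key, ← sum_mul, halt]
  split_ifs with hn <;> simp [hn]

open Finset in
theorem sum_multiIndex_alternating_inv_factorial_mul {ι : Type*} [Fintype ι] [DecidableEq ι]
    (c : ℝ) (hc : c ≠ 0) (γ : ι → ℕ) :
    ∑ β ∈ Iic γ, (-1 : ℝ) ^ (∑ j, β j) / (c ^ (∑ j, β j) * ∏ j, ((β j).factorial : ℝ)) *
      (1 / (c ^ (∑ j, (γ - β) j) * ∏ j, (((γ - β) j).factorial : ℝ))) =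
      if γ = 0 then 1 else 0 := by
  have hI : Iic γ = Fintype.piFinset fun j => Iic (γ j) := by
    ext β; simp [Pi.le_def]
  have hprod : ∀ β ∈ Iic γ,
      (-1 : ℝ) ^ (∑ j, β j) / (c ^ (∑ j, β j) * ∏ j, ((β j).factorial : ℝ)) *
      (1 / (c ^ (∑ j, (γ - β) j) * ∏ j, (((γ - β) j).factorial : ℝ))) =
      ∏ j, ((-1 : ℝ) ^ β j / (c ^ β j * ((β j).factorial : ℝ)) *
        (1 / (c ^ (γ j - β j) * ((γ j - β j).factorial : ℝ)))) := by
    intro β _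
    simp only [prod_mul_distrib, prod_div_distrib, prod_pow_eq_pow_sum, prod_const_one,
      Pi.sub_apply]
  rw [sum_congr rfl hprod, hI,
    ← prod_univ_sum (fun j => Iic (γ j)) (fun j k => (-1 : ℝ) ^ k / (c ^ k * (k.factorial : ℝ)) *
      (1 / (c ^ (γ j - k) * ((γ j - k).factorial : ℝ))))]
  simp only [sum_alternating_inv_factorial_mul c hc]
  simp [prod_ite_zero, funext_iff]

open Finset in
theorem sum_sigma_Iic_half {D : ℕ} {M : Type*} [AddCommMonoid M]
    (α : Fin D → ℕ) (F : (Fin D → ℕ) → (Fin D → ℕ) → M) :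
    ∑ β ∈ (Iic α).filter (fun β => ∀ j, 2 * β j ≤ α j),
      ∑ δ ∈ (Iic fun j => α j - 2 * β j).filter (fun δ => ∀ j, 2 * δ j ≤ α j - 2 * β j), F β δ =
    ∑ γ ∈ (Iic α).filter (fun γ => ∀ j, 2 * γ j ≤ α j), ∑ β ∈ Iic γ, F β (γ - β) := by
  rw [sum_sigma', sum_sigma']
  refine sum_bij' (fun p _ => ⟨p.1 + p.2, p.1⟩) (fun p _ => ⟨p.2, p.1 - p.2⟩) ?_ ?_ ?_ ?_ ?_
  · rintro ⟨β, δ⟩ h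
    simp only [mem_sigma, mem_filter, mem_Iic, Pi.le_def, Pi.add_apply] at h ⊢
    obtain ⟨⟨-, h1⟩, -, h2⟩ := h
    refine ⟨⟨fun j => ?_, fun j => ?_⟩, fun j => ?_⟩ <;> have := h1 j <;> have := h2 j <;> omega
  · rintro ⟨γ, β⟩ h
    simp only [mem_sigma, mem_filter, mem_Iic, Pi.le_def, Pi.sub_apply] at h ⊢
    obtain ⟨⟨-, h1⟩, h2⟩ := h
    refine ⟨⟨fun j => ?_, fun j => ?_⟩, fun j => ?_, fun j => ?_⟩ <;>
      have := h1 j <;> have := h2 j <;> omega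
  · rintro ⟨β, δ⟩ _
    simp
  · rintro ⟨γ, β⟩ h
    have hβ : β ≤ γ := mem_Iic.mp (mem_sigma.mp h).2
    simp [add_tsub_cancel_of_le hβ]
  · rintro ⟨β, δ⟩ _
    simp


/-- Inversion formula between Hermite coefficient functions `f` and momentum-moment
functions `h` indexed by `D`-dimensional multi-indices: if
`h α = Σ_{2β ≤ α} (1/(2^{|β|} β!)) • f (α - 2β)`, then
`f α = Σ_{2β ≤ α} ((-1)^{|β|}/(2^{|β|} β!)) • h (α - 2β)`. -/
theorem multiIndex_inversion (D : ℕ) (hD : 0 < D)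
    (W : Type*) [AddCommGroup W] [Module ℝ W]
    (f h : (Fin D → ℕ) → W)
    (hfh : ∀ α : Fin D → ℕ,
      h α = ∑ β ∈ (Finset.Iic α).filter (fun β => ∀ j, 2 * β j ≤ α j),
        ((1 : ℝ) / (2 ^ (∑ j, β j) * ∏ j, ((β j).factorial : ℝ))) •
          f (fun j => α j - 2 * β j)) :
    ∀ α : Fin D → ℕ,
      f α = ∑ β ∈ (Finset.Iic α).filter (fun β => ∀ j, 2 * β j ≤ α j),
        (((-1 : ℝ) ^ (∑ j, β j)) / (2 ^ (∑ j, β j) * ∏ j, ((β j).factorial : ℝ))) •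
          h (fun j => α j - 2 * β j) := by
  intro α
  have expand : ∀ β : Fin D → ℕ, h (fun j => α j - 2 * β j) = _ := fun β => hfh _
  simp only [expand, Finset.smul_sum, smul_smul]
  rw [sum_sigma_Iic_half α (fun β δ =>
    (((-1 : ℝ) ^ (∑ j, β j)) / (2 ^ (∑ j, β j) * ∏ j, ((β j).factorial : ℝ)) *
      (1 / (2 ^ (∑ j, δ j) * ∏ j, ((δ j).factorial : ℝ)))) •
      f (fun j => α j - 2 * β j - 2 * δ j))]
  have inner : ∀ γ : Fin D → ℕ, ∑ β ∈ Finset.Iic γ,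
      (((-1 : ℝ) ^ (∑ j, β j)) / (2 ^ (∑ j, β j) * ∏ j, ((β j).factorial : ℝ)) *
        (1 / (2 ^ (∑ j, (γ - β) j) * ∏ j, (((γ - β) j).factorial : ℝ)))) •
        f (fun j => α j - 2 * β j - 2 * (γ - β) j) =
      (if γ = 0 then (1 : ℝ) else 0) • f (fun j => α j - 2 * γ j) := by
    intro γ
    rw [← sum_multiIndex_alternating_inv_factorial_mul 2 two_ne_zero γ, Finset.sum_smul]
    refine Finset.sum_congr rfl fun β hβ => ?_
    congr 2
    funext j
    have hj : β j ≤ γ j := Finset.mem_Iic.mp hβ j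
    simp only [Pi.sub_apply]
    omega
  simp only [inner]
  rw [Finset.sum_eq_single 0]
  · simp
  · intro γ _ hγ
    simp [hγ]
  · intro h0
    simp at h0
end

section
/- Define u : ℝ → ℝ by u(x) = (|x|/2 + 1) · x · e^{−x²/8}. Then for every x ≠ 0, u is twice differentiable at x and −u''(x) + (x²/16 + 1/|x|) · u(x) = (5/4) · u(x). That is, u is the ground state of the relative-coordinate Schrödinger operator −d²/dx² + x²/16 + 1/|x| of the one-dimensional Hooke's atom, with energy E_x = 5/4. -/
open Filter Topology in
/-- On each half-line, where `|y| = s * y` with `s = ±1`, the function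
`(|y| / 2 + 1) * y * exp (-y ^ 2 / 8)` satisfies the eigenvalue equation with energy `5/4`. -/
theorem hooke_eigen_of_eventually_abs_eq
    (u : ℝ → ℝ) (hu : ∀ x : ℝ, u x = (|x| / 2 + 1) * x * Real.exp (-x ^ 2 / 8))
    (x s : ℝ) (hx : x ≠ 0) (hs : s ^ 2 = 1) (habs : ∀ᶠ y in 𝓝 x, |y| = s * y) :
    DifferentiableAt ℝ u x ∧ DifferentiableAt ℝ (deriv u) x ∧
      -(deriv (deriv u) x) + (x ^ 2 / 16 + 1 / |x|) * u x = (5 / 4) * u x := by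
  have hexp (y : ℝ) : HasDerivAt (fun y : ℝ => Real.exp (-y ^ 2 / 8))
      (-(y / 4) * Real.exp (-y ^ 2 / 8)) y := by
    exact ((hasDerivAt_pow 2 y).neg.div_const 8).exp.congr_deriv (by simp; ring)
  have hmul (p : ℝ → ℝ) (p' y : ℝ) (hp : HasDerivAt p p' y) :
      HasDerivAt (fun y => p y * Real.exp (-y ^ 2 / 8))
        ((p' - y / 4 * p y) * Real.exp (-y ^ 2 / 8)) y := by
    exact (hp.mul (hexp y)).congr_deriv (by ring)
  have hpoly (a b c d y : ℝ) : HasDerivAt (fun y : ℝ => a + b * y + c * y ^ 2 + d * y ^ 3)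
      (b + 2 * c * y + 3 * d * y ^ 2) y := by
    exact (((((hasDerivAt_id' y).const_mul b).const_add a).add
      ((hasDerivAt_pow 2 y).const_mul c)).add
        ((hasDerivAt_pow 3 y).const_mul d)).congr_deriv (by simp; ring)
  have hfirst : ∀ᶠ y in 𝓝 x, HasDerivAt u
      ((1 + s * y + (-1 / 4) * y ^ 2 + (-s / 8) * y ^ 3) * Real.exp (-y ^ 2 / 8)) y := by
    filter_upwards [habs.eventually_nhds] with y hy
    have h := hmul _ _ y (hpoly 0 1 (s / 2) 0 y)
    have heq : u =ᶠ[𝓝 y]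
        fun z => (0 + 1 * z + s / 2 * z ^ 2 + 0 * z ^ 3) * Real.exp (-z ^ 2 / 8) := by
      filter_upwards [hy] with z hz
      rw [hu, hz]
      ring
    exact (h.congr_of_eventuallyEq heq).congr_deriv (by ring)
  have hsecond := (hmul _ _ x (hpoly 1 s (-1 / 4) (-s / 8) x)).congr_of_eventuallyEq
    (hfirst.mono fun y hy => hy.deriv)
  refine ⟨hfirst.self_of_nhds.differentiableAt, hsecond.differentiableAt, ?_⟩
  have hinv : 1 / |x| * (|x| / 2 + 1) * x = x / 2 + s := by
    have hs0 : s ≠ 0 := by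
      rintro rfl
      norm_num at hs
    rw [habs.self_of_nhds]
    field_simp
    linear_combination (-2) * hs
  rw [hsecond.deriv, add_mul, hu x]
  have hxabs := habs.self_of_nhds
  linear_combination Real.exp (-x ^ 2 / 8) * hinv +
    Real.exp (-x ^ 2 / 8) * (x ^ 3 / 32 - 5 * x / 8) * hxabs

/-- `u(x) = (|x|/2 + 1) x e^{-x²/8}` is, away from the origin, an eigenfunction of the
relative-coordinate Hooke's-atom operator `-d²/dx² + x²/16 + 1/|x|` with energy `5/4`. -/
theorem hooke_relative_ground_state
    (u : ℝ → ℝ) (hu : ∀ x : ℝ, u x = (|x| / 2 + 1) * x * Real.exp (-x ^ 2 / 8)) :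
    ∀ x : ℝ, x ≠ 0 →
      DifferentiableAt ℝ u x ∧ DifferentiableAt ℝ (deriv u) x ∧
      -(deriv (deriv u) x) + (x ^ 2 / 16 + 1 / |x|) * u x = (5 / 4) * u x := by
  intro x hx
  rcases lt_or_gt_of_ne hx with h | h
  · refine hooke_eigen_of_eventually_abs_eq u hu x (-1) hx (by norm_num) ?_
    filter_upwards [eventually_lt_nhds h] with y hy
    rw [abs_of_neg hy, neg_one_mul]
  · refine hooke_eigen_of_eventually_abs_eq u hu x 1 hx (by norm_num) ?_
    filter_upwards [eventually_gt_nhds h] with y hy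
    rw [abs_of_pos hy, one_mul]
end

section
/- Define Ψ : ℝ² → ℝ by Ψ(x₁,x₂) = (|x₁ − x₂|/2 + 1) · (x₁ − x₂) · e^{−(x₁² + x₂²)/4}. Then for every (x₁,x₂) with x₁ ≠ x₂, −(1/2)∂²Ψ/∂x₁² − (1/2)∂²Ψ/∂x₂² + (1/8)x₁²·Ψ + (1/8)x₂²·Ψ + Ψ/|x₁ − x₂| = (3/2)·Ψ. That is, Ψ is (up to normalization) the ground state wave function of the one-dimensional Hooke's atom, with energy E = 3/2. -/
/-- Away from `a`, `(|t - a| / 2 + 1) (t - a)` has derivative `|t - a| + 1`. -/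
lemma hasDerivAt_sub_mul_abs_sub {a t : ℝ} (h : t ≠ a) :
    HasDerivAt (fun t : ℝ => (|t - a| / 2 + 1) * (t - a)) (|t - a| + 1) t := by
  have hu : HasDerivAt (fun t : ℝ => t - a) 1 t := (hasDerivAt_id t).sub_const a
  have habs := (hasDerivAt_abs (sub_ne_zero.mpr h)).comp t hu
  refine (((habs.div_const 2).add_const 1).mul hu).congr_deriv ?_
  have hs : (SignType.sign (t - a) : ℝ) * (t - a) = |t - a| := sign_mul_self _
  simp only [Function.comp_apply]
  linear_combination hs / 2

lemma hasDerivAt_exp_neg_sq_add_div_four (a t : ℝ) :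
    HasDerivAt (fun t : ℝ => Real.exp (-(t ^ 2 + a ^ 2) / 4))
      (-(t / 2) * Real.exp (-(t ^ 2 + a ^ 2) / 4)) t := by
  refine ((((hasDerivAt_pow 2 t).add_const (a ^ 2)).neg.div_const 4).exp).congr_deriv ?_
  simp only [Pi.neg_apply]
  push_cast
  ring

/-- The second partial derivative of the Hooke's-atom wave function off the diagonal. -/
lemma deriv_deriv_hooke {a x : ℝ} (h : x ≠ a) :
    deriv (deriv (fun t : ℝ =>
        (|t - a| / 2 + 1) * (t - a) * Real.exp (-(t ^ 2 + a ^ 2) / 4))) x =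
      ((SignType.sign (x - a) : ℝ) - x * (|x - a| + 1)
        + (x ^ 2 / 4 - 1 / 2) * ((|x - a| / 2 + 1) * (x - a)))
        * Real.exp (-(x ^ 2 + a ^ 2) / 4) := by
  have hfirst : deriv (fun t : ℝ =>
        (|t - a| / 2 + 1) * (t - a) * Real.exp (-(t ^ 2 + a ^ 2) / 4)) =ᶠ[nhds x]
      fun t => (|t - a| + 1 - t / 2 * ((|t - a| / 2 + 1) * (t - a)))
        * Real.exp (-(t ^ 2 + a ^ 2) / 4) := by
    filter_upwards [isOpen_ne.mem_nhds h] with t ht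
    refine (((hasDerivAt_sub_mul_abs_sub ht).mul
      (hasDerivAt_exp_neg_sq_add_div_four a t)).congr_deriv ?_).deriv
    ring
  rw [hfirst.deriv_eq]
  have hu : HasDerivAt (fun t : ℝ => t - a) 1 x := (hasDerivAt_id x).sub_const a
  have habs := (hasDerivAt_abs (sub_ne_zero.mpr h)).comp x hu
  have hlin : HasDerivAt (fun t : ℝ => t / 2) (1 / 2) x := (hasDerivAt_id x).div_const 2
  refine ((((habs.add_const 1).sub (hlin.mul (hasDerivAt_sub_mul_abs_sub h))).mul
    (hasDerivAt_exp_neg_sq_add_div_four a x)).congr_deriv ?_).deriv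
  simp only [Function.comp_apply, Pi.sub_apply, Pi.mul_apply]
  ring

/-- `Ψ(x₁,x₂) = (|x₁-x₂|/2 + 1)(x₁-x₂) e^{-(x₁²+x₂²)/4}` satisfies, away from the
diagonal, the Hooke's-atom Schrödinger equation with energy `3/2`. -/
theorem hooke_atom_ground_state
    (Ψ : ℝ → ℝ → ℝ)
    (hΨ : ∀ x₁ x₂ : ℝ,
      Ψ x₁ x₂ = (|x₁ - x₂| / 2 + 1) * (x₁ - x₂) * Real.exp (-(x₁ ^ 2 + x₂ ^ 2) / 4)) :
    ∀ x₁ x₂ : ℝ, x₁ ≠ x₂ →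
      -(1 / 2) * deriv (deriv (fun t : ℝ => Ψ t x₂)) x₁
        - (1 / 2) * deriv (deriv (fun t : ℝ => Ψ x₁ t)) x₂
        + (1 / 8) * x₁ ^ 2 * Ψ x₁ x₂ + (1 / 8) * x₂ ^ 2 * Ψ x₁ x₂
        + Ψ x₁ x₂ / |x₁ - x₂|
      = (3 / 2) * Ψ x₁ x₂ := by
  intro x₁ x₂ hne
  have hswap : (fun t : ℝ => Ψ x₁ t) = fun t : ℝ =>
      -((|t - x₁| / 2 + 1) * (t - x₁) * Real.exp (-(t ^ 2 + x₁ ^ 2) / 4)) := by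
    funext t
    rw [hΨ, abs_sub_comm, add_comm (x₁ ^ 2)]
    ring
  have hfix : (fun t : ℝ => Ψ t x₂) = fun t : ℝ =>
      (|t - x₂| / 2 + 1) * (t - x₂) * Real.exp (-(t ^ 2 + x₂ ^ 2) / 4) :=
    funext fun t => hΨ t x₂
  rw [hswap, hfix, deriv.fun_neg', deriv.fun_neg, deriv_deriv_hooke hne,
    deriv_deriv_hooke hne.symm, hΨ, add_comm (x₂ ^ 2), abs_sub_comm x₂ x₁]
  rcases lt_or_gt_of_ne (sub_ne_zero.mpr hne) with h | h
  · have h' : 0 < x₂ - x₁ := by linarith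
    rw [abs_of_neg h, sign_neg h, sign_pos h']
    have hn : -(x₁ - x₂) ≠ 0 := by linarith
    simp only [SignType.coe_neg_one, SignType.coe_one]
    field_simp
    ring
  · have h' : x₂ - x₁ < 0 := by linarith
    rw [abs_of_pos h, sign_pos h, sign_neg h']
    simp only [SignType.coe_neg_one, SignType.coe_one]
    field_simp
    ring
end

section
/- For every x ∈ ℝ, ∫_ℝ ((|x − t|/2 + 1) · (x − t))² · e^{−(x² + t²)/2} dt = e^{−x²/2} · ( (4 + 2x²)·e^{−x²/2} + √(2π)·(7/4 + (5/2)x² + (1/4)x⁴) + √(2π)·erf(x/√2)·(3x + x³) ), where erf(x) = (2/√π) ∫₀ˣ e^{−y²} dy. Consequently, the ground state particle density of the one-dimensional Hooke's atom is ρ(x) = 2C² e^{−x²/2}((4+2x²)e^{−x²/2} + √(2π)(7/4 + (5/2)x² + (1/4)x⁴) + √(2π)·erf(x/√2)·(3x + x³)) with C = (16√π + 10π)^{−1/2}. -/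
open MeasureTheory

section

open Filter Topology Set Polynomial

/-- A polynomial times a Gaussian is integrable. -/
theorem integrable_polynomial_mul_exp_neg_mul_sq (p : ℝ[X]) {b : ℝ} (hb : 0 < b) :
    Integrable fun t : ℝ => p.eval t * Real.exp (-b * t ^ 2) := by
  induction p using Polynomial.induction_on' with
  | add p q hp hq =>
    simp only [eval_add, add_mul]
    exact hp.add hq
  | monomial n a =>
    have h := (integrable_rpow_mul_exp_neg_mul_sq hb (s := n)
      (by have : (0 : ℝ) ≤ n := n.cast_nonneg
          linarith)).const_mul a
    simpa only [eval_monomial, Real.rpow_natCast, mul_assoc] using h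

/-- A polynomial times a Gaussian vanishes at infinity. -/
theorem tendsto_polynomial_mul_exp_neg_mul_sq_cocompact (p : ℝ[X]) {b : ℝ} (hb : 0 < b) :
    Tendsto (fun t : ℝ => p.eval t * Real.exp (-b * t ^ 2)) (cocompact ℝ) (𝓝 0) := by
  induction p using Polynomial.induction_on' with
  | add p q hp hq => simpa only [eval_add, add_mul, add_zero] using hp.add hq
  | monomial n a =>
    have h : Tendsto (fun t : ℝ => t ^ n * Real.exp (-b * t ^ 2)) (cocompact ℝ) (𝓝 0) := by
      rw [tendsto_zero_iff_abs_tendsto_zero]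
      refine (tendsto_rpow_abs_mul_exp_neg_mul_sq_cocompact hb n).congr fun t => ?_
      simp [abs_mul]
    simpa only [eval_monomial, mul_assoc, mul_zero] using h.const_mul a

/-- The primitive of the Gaussian `exp (-t² / 2)` vanishing at `0`. -/
noncomputable def gaussianPrimitive (x : ℝ) : ℝ :=
  ∫ t in (0 : ℝ)..x, Real.exp (-(1 / 2) * t ^ 2)

theorem hasDerivAt_gaussianPrimitive (x : ℝ) :
    HasDerivAt gaussianPrimitive (Real.exp (-(1 / 2) * x ^ 2)) x :=
  (by fun_prop : Continuous fun t : ℝ => Real.exp (-(1 / 2) * t ^ 2)).integral_hasStrictDerivAt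
    0 x |>.hasDerivAt

theorem gaussianPrimitive_neg (x : ℝ) : gaussianPrimitive (-x) = -gaussianPrimitive x := by
  have h := intervalIntegral.integral_comp_neg (a := 0) (b := x)
    fun t : ℝ => Real.exp (-(1 / 2) * t ^ 2)
  simp only [neg_sq, neg_zero] at h
  rw [gaussianPrimitive, gaussianPrimitive, h, intervalIntegral.integral_symm]

theorem tendsto_gaussianPrimitive_atTop :
    Tendsto gaussianPrimitive atTop (𝓝 (√(2 * Real.pi) / 2)) := by
  have h := intervalIntegral_tendsto_integral_Ioi 0
    (integrable_exp_neg_mul_sq (b := 1 / 2) (by norm_num)).integrableOn tendsto_id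
  rw [integral_gaussian_Ioi, show Real.pi / (1 / 2) = 2 * Real.pi by ring] at h
  exact h

theorem tendsto_gaussianPrimitive_atBot :
    Tendsto gaussianPrimitive atBot (𝓝 (-(√(2 * Real.pi) / 2))) := by
  refine (tendsto_gaussianPrimitive_atTop.comp tendsto_neg_atBot_atTop).neg.congr fun t => ?_
  simp [gaussianPrimitive_neg]

/-- The error function in terms of the primitive of `exp (-t² / 2)`. -/
theorem sqrt_two_pi_mul_erf_div_sqrt_two (x : ℝ) :
    √(2 * Real.pi) * (2 / √Real.pi * ∫ y in (0 : ℝ)..x / √2, Real.exp (-y ^ 2))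
      = 2 * gaussianPrimitive x := by
  have h := intervalIntegral.integral_comp_div (a := 0) (b := x)
    (fun y : ℝ => Real.exp (-y ^ 2)) (c := √2) (by positivity)
  simp only [zero_div, smul_eq_mul] at h
  have hG : gaussianPrimitive x = ∫ t in (0 : ℝ)..x, Real.exp (-(t / √2) ^ 2) := by
    refine intervalIntegral.integral_congr fun t _ => ?_
    simp only [div_pow, Real.sq_sqrt zero_le_two]
    ring_nf
  rw [hG, h, Real.sqrt_mul zero_le_two]
  have : √Real.pi ≠ 0 := by positivity
  field_simp

/-- For `s = ±1`, the polynomial in `t` equal to `((s u / 2 + 1) u)²` with `u = x - t`. -/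
noncomputable def hookePolynomial (s x : ℝ) : ℝ[X] :=
  C (1 / 4) * (C x - X) ^ 4 + C s * (C x - X) ^ 3 + (C x - X) ^ 2

/-- The polynomial factor of the Gaussian term in a primitive of
`hookePolynomial s x * exp (-t² / 2)`. -/
noncomputable def hookeBoundary (s x : ℝ) : ℝ[X] :=
  C (1 / 4) * (C (4 * x ^ 3) - C (6 * x ^ 2) * X + C (4 * x) * (X ^ 2 + 2) - (X ^ 3 + 3 * X))
    + C s * (C (3 * x ^ 2) - C (3 * x) * X + (X ^ 2 + 2)) + (C (2 * x) - X)

/-- The polynomial moment multiplying the Gaussian primitive in a primitive of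
`hookePolynomial s x * exp (-t² / 2)`. -/
noncomputable def hookeMoment (s x : ℝ) : ℝ :=
  (x ^ 4 + 6 * x ^ 2 + 3) / 4 + s * (x ^ 3 + 3 * x) + (x ^ 2 + 1)

theorem hasDerivAt_hooke_primitive (s x t : ℝ) :
    HasDerivAt (fun t => hookeMoment s x * gaussianPrimitive t
        + (hookeBoundary s x).eval t * Real.exp (-(1 / 2) * t ^ 2))
      ((hookePolynomial s x).eval t * Real.exp (-(1 / 2) * t ^ 2)) t := by
  have hE : HasDerivAt (fun t : ℝ => Real.exp (-(1 / 2) * t ^ 2))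
      (Real.exp (-(1 / 2) * t ^ 2) * (-(1 / 2) * (2 * t))) t := by
    simpa using (((hasDerivAt_id t).pow 2).const_mul (-(1 / 2) : ℝ)).exp
  refine (((hasDerivAt_gaussianPrimitive t).const_mul (hookeMoment s x)).add
    (((hookeBoundary s x).hasDerivAt t).mul hE)).congr_deriv ?_
  simp [hookePolynomial, hookeBoundary, hookeMoment, derivative_pow]
  ring

theorem integral_Iic_hooke (x : ℝ) :
    ∫ t in Iic x, (hookePolynomial 1 x).eval t * Real.exp (-(1 / 2) * t ^ 2)
      = hookeMoment 1 x * (gaussianPrimitive x + √(2 * Real.pi) / 2)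
        + (hookeBoundary 1 x).eval x * Real.exp (-(1 / 2) * x ^ 2) := by
  rw [integral_Iic_of_hasDerivAt_of_tendsto' (fun t _ => hasDerivAt_hooke_primitive 1 x t)
    (integrable_polynomial_mul_exp_neg_mul_sq _ (by norm_num)).integrableOn
    ((tendsto_gaussianPrimitive_atBot.const_mul _).add
      ((tendsto_polynomial_mul_exp_neg_mul_sq_cocompact _ (by norm_num)).mono_left
        atBot_le_cocompact))]
  ring

theorem integral_Ioi_hooke (x : ℝ) :
    ∫ t in Ioi x, (hookePolynomial (-1) x).eval t * Real.exp (-(1 / 2) * t ^ 2)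
      = hookeMoment (-1) x * (√(2 * Real.pi) / 2 - gaussianPrimitive x)
        - (hookeBoundary (-1) x).eval x * Real.exp (-(1 / 2) * x ^ 2) := by
  rw [integral_Ioi_of_hasDerivAt_of_tendsto' (fun t _ => hasDerivAt_hooke_primitive (-1) x t)
    (integrable_polynomial_mul_exp_neg_mul_sq _ (by norm_num)).integrableOn
    ((tendsto_gaussianPrimitive_atTop.const_mul _).add
      ((tendsto_polynomial_mul_exp_neg_mul_sq_cocompact _ (by norm_num)).mono_left
        atTop_le_cocompact))]
  ring

theorem integral_hooke (x : ℝ) :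
    ∫ t : ℝ, ((|x - t| / 2 + 1) * (x - t)) ^ 2 * Real.exp (-(1 / 2) * t ^ 2)
      = (4 + 2 * x ^ 2) * Real.exp (-(1 / 2) * x ^ 2)
        + √(2 * Real.pi) * (7 / 4 + 5 / 2 * x ^ 2 + 1 / 4 * x ^ 4)
        + 2 * gaussianPrimitive x * (3 * x + x ^ 3) := by
  have hl : EqOn (fun t => ((|x - t| / 2 + 1) * (x - t)) ^ 2 * Real.exp (-(1 / 2) * t ^ 2))
      (fun t => (hookePolynomial 1 x).eval t * Real.exp (-(1 / 2) * t ^ 2)) (Iic x) := by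
    intro t ht
    simp only [abs_of_nonneg (sub_nonneg.2 (mem_Iic.1 ht)), hookePolynomial, eval_add, eval_mul,
      eval_C, eval_pow, eval_sub, eval_X]
    ring
  have hr : EqOn (fun t => ((|x - t| / 2 + 1) * (x - t)) ^ 2 * Real.exp (-(1 / 2) * t ^ 2))
      (fun t => (hookePolynomial (-1) x).eval t * Real.exp (-(1 / 2) * t ^ 2)) (Ioi x) := by
    intro t ht
    simp only [abs_of_neg (sub_neg.2 (mem_Ioi.1 ht)), hookePolynomial, eval_add, eval_mul,
      eval_C, eval_pow, eval_sub, eval_X]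
    ring
  have hint (s : ℝ) := integrable_polynomial_mul_exp_neg_mul_sq (hookePolynomial s x)
    (b := 1 / 2) (by norm_num)
  rw [← intervalIntegral.integral_Iic_add_Ioi (b := x)
      ((hint 1).integrableOn.congr_fun hl.symm measurableSet_Iic)
      ((hint (-1)).integrableOn.congr_fun hr.symm measurableSet_Ioi),
    setIntegral_congr_fun measurableSet_Iic hl, setIntegral_congr_fun measurableSet_Ioi hr,
    integral_Iic_hooke, integral_Ioi_hooke]
  simp [hookeBoundary, hookeMoment]
  ring

end

/-- Closed form of `∫ ((|x-t|/2+1)(x-t))² e^{-(x²+t²)/2} dt` in terms of the error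
function, and the resulting ground state particle density of the one-dimensional
Hooke's atom. -/
theorem hooke_atom_density
    (erf : ℝ → ℝ)
    (herf : ∀ x : ℝ, erf x = (2 / Real.sqrt Real.pi) * ∫ y in (0:ℝ)..x, Real.exp (-y ^ 2))
    (C : ℝ) (hC : C = (Real.sqrt (16 * Real.sqrt Real.pi + 10 * Real.pi))⁻¹)
    (ρ : ℝ → ℝ)
    (hρ : ∀ x : ℝ, ρ x = 2 * ∫ t : ℝ,
      (C * (|x - t| / 2 + 1) * (x - t) * Real.exp (-(x ^ 2 + t ^ 2) / 4)) ^ 2) :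
    ∀ x : ℝ,
      (∫ t : ℝ, ((|x - t| / 2 + 1) * (x - t)) ^ 2 * Real.exp (-(x ^ 2 + t ^ 2) / 2)
        = Real.exp (-x ^ 2 / 2) * ((4 + 2 * x ^ 2) * Real.exp (-x ^ 2 / 2)
          + Real.sqrt (2 * Real.pi) * (7 / 4 + 5 / 2 * x ^ 2 + 1 / 4 * x ^ 4)
          + Real.sqrt (2 * Real.pi) * erf (x / Real.sqrt 2) * (3 * x + x ^ 3)))
      ∧ ρ x = 2 * C ^ 2 * Real.exp (-x ^ 2 / 2) * ((4 + 2 * x ^ 2) * Real.exp (-x ^ 2 / 2)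
          + Real.sqrt (2 * Real.pi) * (7 / 4 + 5 / 2 * x ^ 2 + 1 / 4 * x ^ 4)
          + Real.sqrt (2 * Real.pi) * erf (x / Real.sqrt 2) * (3 * x + x ^ 3)) := by
  intro x
  have key : ∫ t : ℝ, ((|x - t| / 2 + 1) * (x - t)) ^ 2 * Real.exp (-(x ^ 2 + t ^ 2) / 2)
      = Real.exp (-x ^ 2 / 2) * ((4 + 2 * x ^ 2) * Real.exp (-x ^ 2 / 2)
        + Real.sqrt (2 * Real.pi) * (7 / 4 + 5 / 2 * x ^ 2 + 1 / 4 * x ^ 4)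
        + Real.sqrt (2 * Real.pi) * erf (x / Real.sqrt 2) * (3 * x + x ^ 3)) := by
    rw [herf, sqrt_two_pi_mul_erf_div_sqrt_two, show -x ^ 2 / 2 = -(1 / 2) * x ^ 2 by ring,
      ← integral_hooke, ← integral_const_mul]
    congr 1 with t
    rw [show -(x ^ 2 + t ^ 2) / 2 = -(1 / 2) * x ^ 2 + -(1 / 2) * t ^ 2 by ring, Real.exp_add]
    ring
  refine ⟨key, ?_⟩
  have hsq (t : ℝ) : (C * (|x - t| / 2 + 1) * (x - t) * Real.exp (-(x ^ 2 + t ^ 2) / 4)) ^ 2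
      = C ^ 2 * (((|x - t| / 2 + 1) * (x - t)) ^ 2 * Real.exp (-(x ^ 2 + t ^ 2) / 2)) := by
    rw [show -(x ^ 2 + t ^ 2) / 2 = -(x ^ 2 + t ^ 2) / 4 + -(x ^ 2 + t ^ 2) / 4 by ring,
      Real.exp_add]
    ring
  simp only [hρ, hsq, integral_const_mul, key]
  ring
end
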